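/- arXiv:2603.08155 — 2 statements merged into one kernel-verified Lean document; each statement's English description precedes it below -/
import Mathlib

section
/- Let n be a positive natural number, R > 0 and s > 0. Let p₀ and q₀ be probability density functions on ℝⁿ that vanish outside the closed ball of radius R centered at the origin. Define the heat-smoothed densities p(x) = ∫_{ℝⁿ} (2πs)^{-n/2} · exp(-‖x - x₀‖² / (2s)) · p₀(x₀) dx₀ and q(x) analogously with q₀ in place of p₀. Then for every x ∈ ℝⁿ, ‖∇ log p(x) - ∇ log q(x)‖ ≤ 2R/s. -/
open MeasureTheory Real
open scoped BigOperators

noncomputable section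

section GaussianSmoothing

variable {E : Type*} [NormedAddCommGroup E]

theorem exp_neg_norm_sub_sq_div_le_one {s : ℝ} (hs : 0 < s) (y a : E) :
    Real.exp (-‖y - a‖ ^ 2 / (2 * s)) ≤ 1 :=
  Real.exp_le_one_iff.2 (div_nonpos_of_nonpos_of_nonneg (by simp) (by positivity))

/-- The derivative of the Gaussian kernel centred at `a`. -/
theorem hasFDerivAt_exp_neg_norm_sub_sq_div [InnerProductSpace ℝ E] (s : ℝ) (a y : E) :
    HasFDerivAt (fun y => Real.exp (-‖y - a‖ ^ 2 / (2 * s)))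
      ((Real.exp (-‖y - a‖ ^ 2 / (2 * s)) * -s⁻¹) • innerSL ℝ (y - a)) y := by
  have h := ((((hasFDerivAt_id (𝕜 := ℝ) y).sub_const a).norm_sq).neg.mul_const (2 * s)⁻¹).exp
  refine (h.congr_fderiv ?_).congr_of_eventuallyEq (.of_forall fun z => by simp [div_eq_mul_inv])
  ext v
  simp [div_eq_mul_inv]
  ring

variable [MeasurableSpace E] [BorelSpace E]
  {μ : Measure E} {f : E → ℝ} {c s R : ℝ}

theorem integrable_gaussian_mul (hs : 0 < s) (hf : Integrable f μ) (y : E) :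
    Integrable (fun a => c * Real.exp (-‖y - a‖ ^ 2 / (2 * s)) * f a) μ := by
  refine hf.bdd_mul (c := |c|) (Continuous.aestronglyMeasurable (by fun_prop))
    (.of_forall fun a => ?_)
  rw [norm_mul, Real.norm_eq_abs, Real.norm_eq_abs, Real.abs_exp]
  exact mul_le_of_le_one_right (abs_nonneg c) (exp_neg_norm_sub_sq_div_le_one hs y a)

theorem integral_gaussian_mul_pos (hc : 0 < c) (hs : 0 < s) (hf : Integrable f μ)
    (hnonneg : ∀ a, 0 ≤ f a) (hpos : 0 < ∫ a, f a ∂μ) (x : E) :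
    0 < ∫ a, c * Real.exp (-‖x - a‖ ^ 2 / (2 * s)) * f a ∂μ := by
  rw [integral_pos_iff_support_of_nonneg hnonneg hf] at hpos
  rw [integral_pos_iff_support_of_nonneg (fun a => by have := hnonneg a; positivity)
    (integrable_gaussian_mul hs hf x)]
  convert hpos using 2
  ext a
  simp [hc.ne']

variable [InnerProductSpace ℝ E] [FiniteDimensional ℝ E]

/-- Differentiation under the integral sign for the Gaussian smoothing of an integrable function
with bounded support. -/
theorem hasFDerivAt_integral_gaussian_mul (hs : 0 < s) (hf : Integrable f μ)
    (hsupp : ∀ a, a ∉ Metric.closedBall (0 : E) R → f a = 0) (x : E) :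
    HasFDerivAt (fun y => ∫ a, c * Real.exp (-‖y - a‖ ^ 2 / (2 * s)) * f a ∂μ)
      (∫ a, (c * Real.exp (-‖x - a‖ ^ 2 / (2 * s)) * f a * -s⁻¹) • innerSL ℝ (x - a) ∂μ) x := by
  refine hasFDerivAt_integral_of_dominated_of_fderiv_le
    (F := fun y a => c * Real.exp (-‖y - a‖ ^ 2 / (2 * s)) * f a)
    (F' := fun y a => (c * Real.exp (-‖y - a‖ ^ 2 / (2 * s)) * f a * -s⁻¹) • innerSL ℝ (y - a))
    (bound := fun a => |c| * s⁻¹ * (‖x‖ + 1 + R) * |f a|)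
    (Metric.ball_mem_nhds x one_pos)
    (.of_forall fun y => (integrable_gaussian_mul hs hf y).aestronglyMeasurable)
    (integrable_gaussian_mul hs hf x) ?_ (.of_forall fun a y hy => ?_) (hf.abs.const_mul _)
    (.of_forall fun a y _ => ?_)
  · exact ((integrable_gaussian_mul hs hf x).aestronglyMeasurable.mul_const _).smul
      (Continuous.aestronglyMeasurable (by fun_prop))
  · by_cases ha : a ∈ Metric.closedBall (0 : E) R
    · have hsub : ‖y - a‖ ≤ ‖x‖ + 1 + R := by
        have hyx : ‖y - x‖ < 1 := mem_ball_iff_norm.1 hy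
        have haR : ‖a‖ ≤ R := mem_closedBall_zero_iff.1 ha
        linarith [norm_sub_le y a, norm_le_norm_add_norm_sub x y, norm_sub_rev x y]
      have hexp := exp_neg_norm_sub_sq_div_le_one hs y a
      rw [norm_smul, innerSL_apply_norm]
      simp only [norm_mul, Real.norm_eq_abs, Real.abs_exp, abs_neg, abs_inv, abs_of_pos hs]
      calc |c| * Real.exp (-‖y - a‖ ^ 2 / (2 * s)) * |f a| * s⁻¹ * ‖y - a‖
          ≤ |c| * 1 * |f a| * s⁻¹ * (‖x‖ + 1 + R) := by gcongr
        _ = |c| * s⁻¹ * (‖x‖ + 1 + R) * |f a| := by ring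
    · simp [hsupp a ha]
  · refine (((hasFDerivAt_exp_neg_norm_sub_sq_div s a y).const_mul c).mul_const
      (f a)).congr_fderiv ?_
    ext v
    simp
    ring

/-- The score of a Gaussian smoothing with variance `s` of a density supported in the ball of
radius `R` is within `R / s` of `-x / s`. -/
theorem norm_gradient_log_integral_gaussian_mul_add_le (hc : 0 < c) (hs : 0 < s)
    (hf : Integrable f μ) (hnonneg : ∀ a, 0 ≤ f a) (hpos : 0 < ∫ a, f a ∂μ)
    (hsupp : ∀ a, a ∉ Metric.closedBall (0 : E) R → f a = 0) (x : E) :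
    ‖gradient (fun y => Real.log (∫ a, c * Real.exp (-‖y - a‖ ^ 2 / (2 * s)) * f a ∂μ)) x
      + s⁻¹ • x‖ ≤ R / s := by
  have hZ := integral_gaussian_mul_pos hc hs hf hnonneg hpos x
  have hD := hasFDerivAt_integral_gaussian_mul (c := c) hs hf hsupp x
  have hint := integrable_gaussian_mul (c := c) hs hf x
  set w : E → ℝ := fun a => c * Real.exp (-‖x - a‖ ^ 2 / (2 * s)) * f a with hw
  have hw_nonneg (a : E) : 0 ≤ w a := by have := hnonneg a; positivity
  have hbound (a : E) : ‖(w a * s⁻¹) • innerSL ℝ a‖ ≤ w a * (R / s) := by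
    by_cases ha : a ∈ Metric.closedBall (0 : E) R
    · rw [norm_smul, innerSL_apply_norm,
        Real.norm_of_nonneg (mul_nonneg (hw_nonneg a) (inv_nonneg.2 hs.le)), mul_assoc,
        div_eq_inv_mul]
      gcongr
      · exact hw_nonneg a
      · exact mem_closedBall_zero_iff.1 ha
    · simp [hw, hsupp a ha]
  have hint_center : Integrable (fun a => (w a * s⁻¹) • innerSL ℝ a) μ :=
    (hint.mul_const (R / s)).mono' ((hint.aestronglyMeasurable.mul_const _).smul
      (Continuous.aestronglyMeasurable (by fun_prop))) (.of_forall hbound)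
  have hsplit : (∫ a, (w a * -s⁻¹) • innerSL ℝ (x - a) ∂μ)
      = (∫ a, (w a * s⁻¹) • innerSL ℝ a ∂μ) - ((∫ a, w a ∂μ) * s⁻¹) • innerSL ℝ x := by
    rw [← integral_mul_const, ← integral_smul_const (fun a => w a * s⁻¹) (innerSL ℝ x),
      ← integral_sub hint_center ((hint.mul_const _).smul_const _)]
    refine integral_congr_ae (.of_forall fun a => ?_)
    simp only [map_sub, smul_sub, mul_neg, neg_smul]
    abel
  have hnorm : ‖∫ a, (w a * s⁻¹) • innerSL ℝ a ∂μ‖ ≤ (∫ a, w a ∂μ) * (R / s) := by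
    rw [← integral_mul_const]
    exact norm_integral_le_of_norm_le (hint.mul_const _) (.of_forall hbound)
  have hdual : InnerProductSpace.toDual ℝ E (gradient
      (fun y => Real.log (∫ a, c * Real.exp (-‖y - a‖ ^ 2 / (2 * s)) * f a ∂μ)) x + s⁻¹ • x)
      = (∫ a, w a ∂μ)⁻¹ • ∫ a, (w a * s⁻¹) • innerSL ℝ a ∂μ := by
    have hx : InnerProductSpace.toDual ℝ E x = innerSL ℝ x := rfl
    rw [gradient, (hD.log hZ.ne').fderiv, hsplit, map_add, LinearIsometryEquiv.apply_symm_apply,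
      smul_sub, smul_smul, inv_mul_cancel_left₀ hZ.ne', map_smulₛₗ, hx]
    simp [hw]
  rw [← LinearIsometryEquiv.norm_map (InnerProductSpace.toDual ℝ E), hdual, norm_smul, norm_inv,
    Real.norm_of_nonneg hZ.le]
  exact (inv_mul_le_iff₀ hZ).2 hnorm

end GaussianSmoothing

/-- VE-SDE score MSE bound (paper's Theorem 2, pointwise in time).
The heat-smoothed densities of two initial densities supported in the closed ball of
radius `R` have score functions whose difference is bounded by `2R/s`. -/
theorem ve_score_mse_bound
    (n : ℕ) (hn : 0 < n) (R s : ℝ) (hR : 0 < R) (hs : 0 < s)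
    (p₀ q₀ : EuclideanSpace ℝ (Fin n) → ℝ)
    (hp₀nonneg : ∀ x, 0 ≤ p₀ x) (hq₀nonneg : ∀ x, 0 ≤ q₀ x)
    (hp₀int : Integrable p₀) (hq₀int : Integrable q₀)
    (hp₀one : ∫ x, p₀ x = 1) (hq₀one : ∫ x, q₀ x = 1)
    (hp₀supp : ∀ x, x ∉ Metric.closedBall (0 : EuclideanSpace ℝ (Fin n)) R → p₀ x = 0)
    (hq₀supp : ∀ x, x ∉ Metric.closedBall (0 : EuclideanSpace ℝ (Fin n)) R → q₀ x = 0)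
    (p q : EuclideanSpace ℝ (Fin n) → ℝ)
    (hp : ∀ x, p x =
      ∫ x₀, (2 * π * s) ^ (-(n : ℝ) / 2) * Real.exp (-‖x - x₀‖ ^ 2 / (2 * s)) * p₀ x₀)
    (hq : ∀ x, q x =
      ∫ x₀, (2 * π * s) ^ (-(n : ℝ) / 2) * Real.exp (-‖x - x₀‖ ^ 2 / (2 * s)) * q₀ x₀) :
    ∀ x : EuclideanSpace ℝ (Fin n),
      ‖gradient (fun y => Real.log (p y)) x - gradient (fun y => Real.log (q y)) x‖
        ≤ 2 * R / s := by
  intro x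
  have hc : 0 < (2 * π * s) ^ (-(n : ℝ) / 2) := by positivity
  have hp' := norm_gradient_log_integral_gaussian_mul_add_le hc hs hp₀int hp₀nonneg
    (by rw [hp₀one]; exact one_pos) hp₀supp x
  have hq' := norm_gradient_log_integral_gaussian_mul_add_le hc hs hq₀int hq₀nonneg
    (by rw [hq₀one]; exact one_pos) hq₀supp x
  simp only [← hp] at hp'
  simp only [← hq] at hq'
  calc ‖gradient (fun y => Real.log (p y)) x - gradient (fun y => Real.log (q y)) x‖
      = ‖(gradient (fun y => Real.log (p y)) x + s⁻¹ • x)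
          - (gradient (fun y => Real.log (q y)) x + s⁻¹ • x)‖ := by rw [add_sub_add_right_eq_sub]
    _ ≤ R / s + R / s := (norm_sub_le _ _).trans (add_le_add hp' hq')
    _ = 2 * R / s := by ring
end
end

section
/- Let n be a positive natural number and let p : ℝⁿ × (0, ∞) → ℝ be everywhere positive, twice continuously differentiable in the space variable and once continuously differentiable in the time variable, and satisfy the heat equation ∂_s p(x, s) = Δ_x p(x, s) on ℝⁿ × (0, ∞). Then for every real α > 1, all points x₁, x₂ ∈ ℝⁿ and all times 0 < s₁ < s₂ < ∞: p(x₁, s₁) ≤ p(x₂, s₂) · (s₂/s₁)^{nα/2} · exp( α²‖x₁ - x₂‖² / (4(s₂ - s₁)) ). -/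
open MeasureTheory Real
open scoped BigOperators RealInnerProductSpace

noncomputable section

/-- The Euclidean Laplacian `Δf(x) = Σᵢ ∂²f/∂xᵢ²(x)` of `f : ℝⁿ → ℝ`. -/
def lap {n : ℕ} (f : EuclideanSpace ℝ (Fin n) → ℝ) (x : EuclideanSpace ℝ (Fin n)) : ℝ :=
  ∑ i : Fin n,
    fderiv ℝ (fun y => fderiv ℝ f y (EuclideanSpace.single i 1)) x (EuclideanSpace.single i 1)

open Set Filter Topology

/-! ### The Laplacian of `C²` functions -/

section Laplacian

variable {n : ℕ} {f g : EuclideanSpace ℝ (Fin n) → ℝ}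

lemma contDiff_fderiv_apply_const (hf : ContDiff ℝ 2 f) (v : EuclideanSpace ℝ (Fin n)) :
    ContDiff ℝ 1 (fun y => fderiv ℝ f y v) :=
  (hf.fderiv_right (m := 1) (by norm_num)).clm_apply contDiff_const

lemma continuous_lap (hf : ContDiff ℝ 2 f) : Continuous (lap f) := by
  unfold lap
  refine continuous_finsetSum _ fun i _ => ?_
  exact ((contDiff_fderiv_apply_const hf _).continuous_fderiv (by norm_num)).clm_apply
    continuous_const

lemma lap_eq_zero_of_eventuallyEq {x : EuclideanSpace ℝ (Fin n)} {c : ℝ}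
    (h : f =ᶠ[𝓝 x] fun _ => c) : lap f x = 0 := by
  unfold lap
  refine Finset.sum_eq_zero fun i _ => ?_
  have h1 : (fun y => fderiv ℝ f y (EuclideanSpace.single i 1)) =ᶠ[𝓝 x] fun _ => (0 : ℝ) := by
    filter_upwards [h.fderiv (𝕜 := ℝ)] with y hy
    simp [hy]
  simp [h1.fderiv_eq]

lemma lap_mul (hf : ContDiff ℝ 2 f) (hg : ContDiff ℝ 2 g) (x : EuclideanSpace ℝ (Fin n)) :
    lap (fun y => f y * g y) x = f x * lap g x +
      2 * ∑ i : Fin n, fderiv ℝ f x (EuclideanSpace.single i 1) *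
        fderiv ℝ g x (EuclideanSpace.single i 1) + g x * lap f x := by
  have hfd : Differentiable ℝ f := hf.differentiable (by norm_num)
  have hgd : Differentiable ℝ g := hg.differentiable (by norm_num)
  unfold lap
  rw [Finset.mul_sum, Finset.mul_sum, Finset.mul_sum, ← Finset.sum_add_distrib,
    ← Finset.sum_add_distrib]
  refine Finset.sum_congr rfl fun i _ => ?_
  set e : EuclideanSpace ℝ (Fin n) := EuclideanSpace.single i 1
  have hfe : Differentiable ℝ (fun y => fderiv ℝ f y e) :=
    (contDiff_fderiv_apply_const hf e).differentiable (by norm_num)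
  have hge : Differentiable ℝ (fun y => fderiv ℝ g y e) :=
    (contDiff_fderiv_apply_const hg e).differentiable (by norm_num)
  have h1 : (fun y => fderiv ℝ (fun y => f y * g y) y e) =
      fun y => f y * fderiv ℝ g y e + g y * fderiv ℝ f y e := by
    funext y
    rw [fderiv_fun_mul (hfd y) (hgd y)]
    simp
  rw [h1, fderiv_fun_add ((hfd x).fun_mul (hge x)) ((hgd x).fun_mul (hfe x)),
    fderiv_fun_mul (hfd x) (hge x), fderiv_fun_mul (hgd x) (hfe x)]
  simp
  ring

lemma lap_comp {θ θ' θ'' : ℝ → ℝ} (hθ : ∀ r, HasDerivAt θ (θ' r) r)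
    (hθ' : ∀ r, HasDerivAt θ' (θ'' r) r) (hf : ContDiff ℝ 2 f) (x : EuclideanSpace ℝ (Fin n)) :
    lap (fun y => θ (f y)) x = θ' (f x) * lap f x +
      θ'' (f x) * ∑ i : Fin n, (fderiv ℝ f x (EuclideanSpace.single i 1)) ^ 2 := by
  have hfd : Differentiable ℝ f := hf.differentiable (by norm_num)
  unfold lap
  rw [Finset.mul_sum, Finset.mul_sum, ← Finset.sum_add_distrib]
  refine Finset.sum_congr rfl fun i _ => ?_
  set e : EuclideanSpace ℝ (Fin n) := EuclideanSpace.single i 1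
  have hfe : Differentiable ℝ (fun y => fderiv ℝ f y e) :=
    (contDiff_fderiv_apply_const hf e).differentiable (by norm_num)
  have h1 : (fun y => fderiv ℝ (fun y => θ (f y)) y e) = fun y => θ' (f y) * fderiv ℝ f y e := by
    funext y
    have h := ((hθ (f y)).comp_hasFDerivAt y (hfd y).hasFDerivAt).fderiv
    change fderiv ℝ (fun y => θ (f y)) y = _ at h
    simp [h]
  have h2 := (hθ' (f x)).comp_hasFDerivAt x (hfd x).hasFDerivAt
  rw [h1]
  have h3 := (h2.mul (hfe x).hasFDerivAt).fderiv
  change fderiv ℝ (fun y => θ' (f y) * fderiv ℝ f y e) x = _ at h3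
  rw [h3]
  simp
  ring

lemma lap_neg : lap (fun y => -f y) = fun x => -lap f x := by
  funext x
  simp only [lap, fderiv_fun_neg, neg_apply, Finset.sum_neg_distrib]

lemma integrable_mul_of_hasCompactSupport (hf : Continuous f) (hg : Continuous g)
    (hc : HasCompactSupport f) : Integrable (fun x => f x * g x) :=
  (hf.mul hg).integrable_of_hasCompactSupport hc.mul_right

lemma hasCompactSupport_fderiv_apply (hc : HasCompactSupport f)
    (v : EuclideanSpace ℝ (Fin n)) : HasCompactSupport (fun y => fderiv ℝ f y v) :=
  (hc.fderiv (𝕜 := ℝ)).comp_left (g := fun l : EuclideanSpace ℝ (Fin n) →L[ℝ] ℝ => l v) rfl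

lemma hasCompactSupport_lap (hc : HasCompactSupport f) : HasCompactSupport (lap f) := by
  refine hc.mono' fun x hx => ?_
  by_contra h
  exact hx (lap_eq_zero_of_eventuallyEq (c := 0) (notMem_tsupport_iff_eventuallyEq.1 h))

/-- Green's second identity for a compactly supported factor. -/
lemma integral_mul_lap (hf : ContDiff ℝ 2 f) (hc : HasCompactSupport f) (hg : ContDiff ℝ 2 g) :
    ∫ x, f x * lap g x = ∫ x, lap f x * g x := by
  have hfd : Differentiable ℝ f := hf.differentiable (by norm_num)
  have hgd : Differentiable ℝ g := hg.differentiable (by norm_num)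
  unfold lap
  simp only [Finset.mul_sum, Finset.sum_mul]
  have c1 : ∀ {u : EuclideanSpace ℝ (Fin n) → ℝ}, ContDiff ℝ 2 u → ∀ v,
      Continuous fun y => fderiv ℝ u y v :=
    fun hu v => (contDiff_fderiv_apply_const hu v).continuous
  have c2 : ∀ {u : EuclideanSpace ℝ (Fin n) → ℝ}, ContDiff ℝ 2 u → ∀ v w,
      Continuous fun y => fderiv ℝ (fun y => fderiv ℝ u y v) y w := fun hu v w =>
    ((contDiff_fderiv_apply_const hu v).continuous_fderiv (by norm_num)).clm_apply continuous_const
  have hd : ∀ {u : EuclideanSpace ℝ (Fin n) → ℝ}, ContDiff ℝ 2 u → ∀ v,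
      Differentiable ℝ (fun y => fderiv ℝ u y v) :=
    fun hu v => (contDiff_fderiv_apply_const hu v).differentiable (by norm_num)
  have s1 := fun v => hasCompactSupport_fderiv_apply hc v
  have s2 := fun v w => hasCompactSupport_fderiv_apply (s1 v) w
  rw [integral_finsetSum _ fun i _ =>
      integrable_mul_of_hasCompactSupport hf.continuous (c2 hg _ _) hc,
    integral_finsetSum _ fun i _ =>
      integrable_mul_of_hasCompactSupport (c2 hf _ _) hg.continuous (s2 _ _)]
  refine Finset.sum_congr rfl fun i _ => ?_
  set e : EuclideanSpace ℝ (Fin n) := EuclideanSpace.single i 1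
  rw [integral_mul_fderiv_eq_neg_fderiv_mul_of_integrable
      (integrable_mul_of_hasCompactSupport (c1 hf e) (c1 hg e) (s1 e))
      (integrable_mul_of_hasCompactSupport hf.continuous (c2 hg e e) hc)
      (integrable_mul_of_hasCompactSupport hf.continuous (c1 hg e) hc)
      (fun x _ => hfd x) (fun x _ => hd hg e x),
    integral_mul_fderiv_eq_neg_fderiv_mul_of_integrable
      (integrable_mul_of_hasCompactSupport (c2 hf e e) hg.continuous (s2 e e))
      (integrable_mul_of_hasCompactSupport (c1 hf e) (c1 hg e) (s1 e))
      (integrable_mul_of_hasCompactSupport (c1 hf e) hg.continuous (s1 e))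
      (fun x _ => hd hf e x) (fun x _ => hgd x), neg_neg]

end Laplacian

/-! ### The heat kernel -/

/-- The Gauss-Weierstrass kernel of `∂ₕ - Δ` on `ℝⁿ`. -/
def heatKernel {n : ℕ} (w : EuclideanSpace ℝ (Fin n)) (h : ℝ) : ℝ :=
  (4 * π * h) ^ (-(n : ℝ) / 2) * exp (-‖w‖ ^ 2 / (4 * h))

section HeatKernel

variable {n : ℕ}

lemma heatKernel_pos (w : EuclideanSpace ℝ (Fin n)) {h : ℝ} (hh : 0 < h) : 0 < heatKernel w h := by
  unfold heatKernel
  positivity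

lemma heatKernel_le (w : EuclideanSpace ℝ (Fin n)) {h : ℝ} (hh : 0 < h) :
    heatKernel w h ≤ (4 * π * h) ^ (-(n : ℝ) / 2) := by
  unfold heatKernel
  refine mul_le_of_le_one_right (by positivity) (exp_le_one_iff.2 ?_)
  rw [neg_div]
  exact neg_nonpos.2 (by positivity)

lemma contDiff_heatKernel (y : EuclideanSpace ℝ (Fin n)) (h : ℝ) :
    ContDiff ℝ 2 (fun z => heatKernel (z - y) h) := by
  unfold heatKernel
  have h1 : ContDiff ℝ 2 (fun z : EuclideanSpace ℝ (Fin n) => ‖z - y‖ ^ 2) :=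
    (contDiff_id.sub contDiff_const).norm_sq ℝ
  exact contDiff_const.mul ((h1.neg.div_const _).exp)

lemma continuous_heatKernel (y : EuclideanSpace ℝ (Fin n)) (h : ℝ) :
    Continuous (fun z => heatKernel (z - y) h) := (contDiff_heatKernel y h).continuous

lemma hasDerivAt_heatKernel (w : EuclideanSpace ℝ (Fin n)) {h : ℝ} (hh : 0 < h) :
    HasDerivAt (heatKernel w) ((‖w‖ ^ 2 / (4 * h ^ 2) - n / (2 * h)) * heatKernel w h) h := by
  have h1 : HasDerivAt (fun h : ℝ => (4 * π * h) ^ (-(n : ℝ) / 2))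
      (4 * π * (-(n : ℝ) / 2) * (4 * π * h) ^ (-(n : ℝ) / 2 - 1)) h := by
    have := ((hasDerivAt_id h).const_mul (4 * π)).rpow_const (p := -(n : ℝ) / 2)
      (Or.inl (by simp only [id]; positivity))
    simpa using this
  have h2 : HasDerivAt (fun h : ℝ => exp (-‖w‖ ^ 2 / (4 * h)))
      (exp (-‖w‖ ^ 2 / (4 * h)) * (‖w‖ ^ 2 / (4 * h ^ 2))) h := by
    have h3 : HasDerivAt (fun h : ℝ => -‖w‖ ^ 2 / (4 * h)) (‖w‖ ^ 2 / (4 * h ^ 2)) h := by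
      have := (hasDerivAt_const h (-‖w‖ ^ 2)).div ((hasDerivAt_id h).const_mul 4)
        (by simp only [id]; positivity)
      refine this.congr_deriv ?_
      simp only [id]
      field_simp
      ring
    exact h3.exp
  refine (h1.mul h2).congr_deriv ?_
  unfold heatKernel
  rw [rpow_sub (by positivity), rpow_one]
  field_simp
  ring

lemma fderiv_heatKernel (y z v : EuclideanSpace ℝ (Fin n)) {h : ℝ} (hh : 0 < h) :
    fderiv ℝ (fun z => heatKernel (z - y) h) z v =
      -(⟪z - y, v⟫ / (2 * h)) * heatKernel (z - y) h := by
  have h1 : HasFDerivAt (fun z : EuclideanSpace ℝ (Fin n) => ‖z - y‖ ^ 2)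
      (2 • (innerSL ℝ (z - y))) z := by
    have := ((hasFDerivAt_id z).sub_const y).norm_sq
    refine this.congr_fderiv ?_
    ext v
    simp
  have h2 := ((h1.fun_neg.mul_const (4 * h)⁻¹).exp).const_mul ((4 * π * h) ^ (-(n : ℝ) / 2))
  unfold heatKernel
  simp only [div_eq_mul_inv] at h2 ⊢
  rw [h2.fderiv]
  simp [inner_sub_left]
  field_simp
  ring

lemma lap_heatKernel (y z : EuclideanSpace ℝ (Fin n)) {h : ℝ} (hh : 0 < h) :
    lap (fun z => heatKernel (z - y) h) z =
      (‖z - y‖ ^ 2 / (4 * h ^ 2) - n / (2 * h)) * heatKernel (z - y) h := by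
  unfold lap
  have hk : DifferentiableAt ℝ (fun z => heatKernel (z - y) h) z :=
    (contDiff_heatKernel y h).differentiable (by norm_num) z
  have h1 : ∀ i : Fin n, fderiv ℝ (fun z => fderiv ℝ (fun z => heatKernel (z - y) h) z
      (EuclideanSpace.single i 1)) z (EuclideanSpace.single i 1) =
      ((z - y) i ^ 2 / (4 * h ^ 2) - 1 / (2 * h)) * heatKernel (z - y) h := by
    intro i
    set e : EuclideanSpace ℝ (Fin n) := EuclideanSpace.single i 1
    have h2 : (fun z => fderiv ℝ (fun z => heatKernel (z - y) h) z e) =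
        fun z => (-(2 * h)⁻¹ * innerSL ℝ e (z - y)) * heatKernel (z - y) h := by
      funext z
      rw [fderiv_heatKernel y z e hh]
      simp only [innerSL_apply_apply]
      rw [real_inner_comm]
      ring
    have h3 : HasFDerivAt (fun z => -(2 * h)⁻¹ * innerSL ℝ e (z - y))
        (-(2 * h)⁻¹ • innerSL ℝ e) z :=
      (((innerSL ℝ e).hasFDerivAt.comp z ((hasFDerivAt_id z).sub_const y)).const_mul _)
    rw [h2, (h3.fun_mul hk.hasFDerivAt).fderiv]
    simp only [add_apply, smul_apply, smul_eq_mul]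
    rw [fderiv_heatKernel y z e hh]
    have h4 : ⟪z - y, e⟫ = (z - y) i := by
      simp [e, EuclideanSpace.inner_single_right]
    have h5 : ⟪e, z - y⟫ = (z - y) i := by rw [real_inner_comm, h4]
    have h6 : ⟪e, e⟫ = (1 : ℝ) := by simp [e]
    rw [innerSL_apply_apply, innerSL_apply_apply, h4, h5, h6]
    field_simp
    ring
  rw [Finset.sum_congr rfl fun i _ => h1 i, ← Finset.sum_mul, Finset.sum_sub_distrib,
    ← Finset.sum_div, EuclideanSpace.norm_sq_eq]
  simp
  left
  ring

/-- The commutator of the backward heat operator with the cut-off `χ`, applied to the kernel. -/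
def kernelCommutator (χ : EuclideanSpace ℝ (Fin n) → ℝ) (y : EuclideanSpace ℝ (Fin n)) (h : ℝ)
    (z : EuclideanSpace ℝ (Fin n)) : ℝ :=
  (lap χ z - fderiv ℝ χ z (z - y) / h) * heatKernel (z - y) h

lemma lap_mul_heatKernel {χ : EuclideanSpace ℝ (Fin n) → ℝ} (hχ : ContDiff ℝ 2 χ)
    (y z : EuclideanSpace ℝ (Fin n)) {h : ℝ} (hh : 0 < h) :
    -(χ z * ((‖z - y‖ ^ 2 / (4 * h ^ 2) - n / (2 * h)) * heatKernel (z - y) h)) +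
      lap (fun z => χ z * heatKernel (z - y) h) z = kernelCommutator χ y h z := by
  rw [lap_mul hχ (contDiff_heatKernel y h), lap_heatKernel y z hh]
  have h1 : ∑ i : Fin n, fderiv ℝ χ z (EuclideanSpace.single i 1) *
      fderiv ℝ (fun z => heatKernel (z - y) h) z (EuclideanSpace.single i 1) =
      -(fderiv ℝ χ z (z - y) / (2 * h)) * heatKernel (z - y) h := by
    have h2 : z - y = ∑ i : Fin n, (z - y) i • (EuclideanSpace.single i (1 : ℝ)) := by
      have := (EuclideanSpace.basisFun (Fin n) ℝ).sum_repr (z - y)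
      simpa using this.symm
    have h3 : fderiv ℝ χ z (z - y) =
        ∑ i : Fin n, (z - y) i * fderiv ℝ χ z (EuclideanSpace.single i 1) := by
      conv_lhs => rw [h2]
      simp [map_sum]
    rw [h3, Finset.sum_div, ← Finset.sum_neg_distrib, Finset.sum_mul]
    refine Finset.sum_congr rfl fun i _ => ?_
    rw [fderiv_heatKernel y z _ hh]
    simp only [EuclideanSpace.inner_single_right]
    simp
    ring
  rw [h1]
  unfold kernelCommutator
  field_simp
  ring

end HeatKernel

/-! ### Integrals against the heat kernel -/

section Fatou

variable {X : Type*} [MeasurableSpace X] {μ : Measure X}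

/-- Fatou's lemma for Bochner integrals with convergent upper bounds. -/
lemma integrable_and_integral_le_of_tendsto {ι : Type*} {l : Filter ι} [l.NeBot]
    [l.IsCountablyGenerated] {g : ι → X → ℝ} {G : X → ℝ} {b : ι → ℝ} {B : ℝ}
    (hgi : ∀ᶠ j in l, Integrable (g j) μ) (hnonneg : ∀ᶠ j in l, ∀ x, 0 ≤ g j x)
    (hlim : ∀ x, Tendsto (fun j => g j x) l (𝓝 (G x)))
    (hle : ∀ᶠ j in l, ∫ x, g j x ∂μ ≤ b j) (hb : Tendsto b l (𝓝 B)) :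
    Integrable G μ ∧ ∫ x, G x ∂μ ≤ B := by
  obtain ⟨u, hu⟩ := l.exists_seq_tendsto
  obtain ⟨N, hN⟩ := eventually_atTop.1 (hu.eventually ((hgi.and hnonneg).and hle))
  set v : ℕ → ι := fun k => u (k + N) with hv
  have hvl : Tendsto v atTop l := hu.comp (tendsto_add_atTop_nat N)
  have hgi' : ∀ k, Integrable (g (v k)) μ := fun k => (hN (k + N) (by omega)).1.1
  have hnn : ∀ k x, 0 ≤ g (v k) x := fun k => (hN (k + N) (by omega)).1.2
  have hle' : ∀ k, ∫ x, g (v k) x ∂μ ≤ b (v k) := fun k => (hN (k + N) (by omega)).2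
  have hlim' : ∀ x, Tendsto (fun k => g (v k) x) atTop (𝓝 (G x)) := fun x => (hlim x).comp hvl
  have hb' : Tendsto (fun k => b (v k)) atTop (𝓝 B) := hb.comp hvl
  have hG : ∀ x, 0 ≤ G x := fun x => ge_of_tendsto' (hlim' x) fun k => hnn k x
  have hB : 0 ≤ B := ge_of_tendsto' hb' fun k => (integral_nonneg (hnn k)).trans (hle' k)
  have hmeas : AEStronglyMeasurable G μ :=
    aestronglyMeasurable_of_tendsto_ae atTop (fun k => (hgi' k).aestronglyMeasurable)
      (Eventually.of_forall hlim')
  have key : ∫⁻ x, ENNReal.ofReal (G x) ∂μ ≤ ENNReal.ofReal B := by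
    have h1 : ∀ x, ENNReal.ofReal (G x) =
        liminf (fun k => ENNReal.ofReal (g (v k) x)) atTop := fun x =>
      ((ENNReal.tendsto_ofReal (hlim' x)).liminf_eq).symm
    simp_rw [h1]
    refine (lintegral_liminf_le' fun k =>
      (hgi' k).aestronglyMeasurable.aemeasurable.ennreal_ofReal).trans ?_
    have h2 : Tendsto (fun k => ENNReal.ofReal (b (v k))) atTop (𝓝 (ENNReal.ofReal B)) :=
      ENNReal.tendsto_ofReal hb'
    rw [← h2.liminf_eq]
    refine liminf_le_liminf (Eventually.of_forall fun k => ?_)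
    rw [← ofReal_integral_eq_lintegral_ofReal (hgi' k) (Eventually.of_forall (hnn k))]
    exact ENNReal.ofReal_le_ofReal (hle' k)
  refine ⟨⟨hmeas, ?_⟩, ?_⟩
  · rw [hasFiniteIntegral_iff_ofReal (Eventually.of_forall hG)]
    exact key.trans_lt ENNReal.ofReal_lt_top
  · rw [integral_eq_lintegral_of_nonneg_ae (Eventually.of_forall hG) hmeas]
    exact (ENNReal.toReal_mono ENNReal.ofReal_ne_top key).trans_eq (ENNReal.toReal_ofReal hB)

end Fatou

section KernelIntegral

variable {n : ℕ}

lemma continuousAt_heatKernel (w : EuclideanSpace ℝ (Fin n)) {h : ℝ} (hh : 0 < h) :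
    ContinuousAt (heatKernel w) h := (hasDerivAt_heatKernel w hh).continuousAt

lemma integrable_heatKernel {h : ℝ} (hh : 0 < h) :
    Integrable (fun w : EuclideanSpace ℝ (Fin n) => heatKernel w h) := by
  have h1 := GaussianFourier.integrable_cexp_neg_mul_sq_norm_add (V := EuclideanSpace ℝ (Fin n))
    (b := ((4 * h)⁻¹ : ℝ)) (by simp; positivity) 0 0
  have h2 := h1.re
  simp only [zero_mul, add_zero] at h2
  refine (h2.const_mul ((4 * π * h) ^ (-(n : ℝ) / 2))).congr (Eventually.of_forall fun w => ?_)
  simp only [heatKernel]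
  congr 1
  have h3 : (-(((4 * h)⁻¹ : ℝ) : ℂ) * (‖w‖ : ℂ) ^ 2) = ((-‖w‖ ^ 2 / (4 * h) : ℝ) : ℂ) := by
    push_cast
    ring
  rw [h3, ← Complex.ofReal_exp]
  rfl

lemma integral_heatKernel {h : ℝ} (hh : 0 < h) :
    ∫ w : EuclideanSpace ℝ (Fin n), heatKernel w h = 1 := by
  have h1 := GaussianFourier.integral_rexp_neg_mul_sq_norm (V := EuclideanSpace ℝ (Fin n))
    (b := (4 * h)⁻¹) (by positivity)
  have h2 : ∀ w : EuclideanSpace ℝ (Fin n), heatKernel w h =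
      (4 * π * h) ^ (-(n : ℝ) / 2) * exp (-(4 * h)⁻¹ * ‖w‖ ^ 2) := fun w => by
    simp only [heatKernel]
    congr 2
    ring
  simp_rw [h2]
  rw [integral_const_mul, h1, finrank_euclideanSpace_fin]
  have h3 : π / (4 * h)⁻¹ = 4 * π * h := by field_simp
  rw [h3, ← rpow_add (by positivity)]
  simp [neg_div]

lemma integrable_heatKernel_sub (y : EuclideanSpace ℝ (Fin n)) {h : ℝ} (hh : 0 < h) :
    Integrable (fun z => heatKernel (z - y) h) := (integrable_heatKernel hh).comp_sub_right y

lemma integral_heatKernel_sub (y : EuclideanSpace ℝ (Fin n)) {h : ℝ} (hh : 0 < h) :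
    ∫ z, heatKernel (z - y) h = 1 := by
  rw [integral_sub_right_eq_self (fun z => heatKernel z h) y, integral_heatKernel hh]

lemma integrable_heatKernel_mul (y : EuclideanSpace ℝ (Fin n)) {h : ℝ} (hh : 0 < h)
    {g : EuclideanSpace ℝ (Fin n) → ℝ} (hg : Continuous g) {C : ℝ} (hC : ∀ z, |g z| ≤ C) :
    Integrable (fun z => heatKernel (z - y) h * g z) :=
  (integrable_heatKernel_sub y hh).mul_bdd hg.aestronglyMeasurable
    (Eventually.of_forall fun z => by simpa using hC z)

lemma abs_integral_heatKernel_mul_le (y : EuclideanSpace ℝ (Fin n)) {h : ℝ} (hh : 0 < h)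
    {g : EuclideanSpace ℝ (Fin n) → ℝ} {C : ℝ} (hC : ∀ z, |g z| ≤ C) :
    |∫ z, heatKernel (z - y) h * g z| ≤ C := by
  have h1 := norm_integral_le_of_norm_le (μ := volume) (f := fun z => heatKernel (z - y) h * g z)
    ((integrable_heatKernel_sub y hh).mul_const C)
    (Eventually.of_forall fun z => ?_)
  · rwa [integral_mul_const, integral_heatKernel_sub y hh, one_mul] at h1
  · rw [norm_mul, Real.norm_of_nonneg (heatKernel_pos _ hh).le]
    exact mul_le_mul_of_nonneg_left (hC z) (heatKernel_pos _ hh).le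

lemma heatKernel_smul (w : EuclideanSpace ℝ (Fin n)) {c : ℝ} (hc : 0 < c) :
    heatKernel (c • w) (c ^ 2) = (c ^ n)⁻¹ * heatKernel w 1 := by
  simp only [heatKernel, norm_smul, Real.norm_of_nonneg hc.le]
  rw [mul_one, mul_rpow (by positivity) (by positivity), ← rpow_natCast c 2, ← rpow_mul hc.le]
  have h1 : ((2 : ℕ) : ℝ) * (-(n : ℝ) / 2) = -(n : ℝ) := by push_cast; ring
  have h2 : -(c * ‖w‖) ^ 2 / (4 * c ^ ((2 : ℕ) : ℝ)) = -‖w‖ ^ 2 / (4 * 1) := by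
    rw [rpow_natCast]
    field_simp
  rw [h1, h2, rpow_neg hc.le, rpow_natCast, mul_one]
  ring

/-- The heat kernel is an approximate identity. -/
lemma tendsto_integral_heatKernel_mul (y : EuclideanSpace ℝ (Fin n))
    {g : EuclideanSpace ℝ (Fin n) → ℝ} (hg : Continuous g) {C : ℝ} (hC : ∀ z, |g z| ≤ C) :
    Tendsto (fun h => ∫ z, heatKernel (z - y) h * g z) (𝓝[>] 0) (𝓝 (g y)) := by
  have h1 : ∀ h ∈ Ioi (0 : ℝ), ∫ w, heatKernel w 1 * g (y + √h • w) =
      ∫ z, heatKernel (z - y) h * g z := by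
    intro h hh
    have hc : 0 < √h := sqrt_pos.2 hh
    have h2 := Measure.integral_comp_smul (volume : Measure (EuclideanSpace ℝ (Fin n)))
      (fun w => heatKernel w h * g (y + w)) √h
    have h3 := integral_sub_right_eq_self (μ := volume)
      (fun w => heatKernel w h * g (y + w)) y
    simp only [add_sub_cancel] at h3
    have h4 : ∀ w : EuclideanSpace ℝ (Fin n),
        heatKernel (√h • w) h = (√h ^ n)⁻¹ * heatKernel w 1 := fun w => by
      have := heatKernel_smul w hc
      rwa [sq_sqrt (le_of_lt hh)] at this
    simp_rw [h4, mul_assoc] at h2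
    rw [integral_const_mul, finrank_euclideanSpace_fin, abs_of_nonneg (by positivity),
      smul_eq_mul] at h2
    rw [h3]
    exact mul_left_cancel₀ (by positivity) h2
  refine Tendsto.congr' (eventually_nhdsWithin_of_forall h1) ?_
  have h5 : g y = ∫ w : EuclideanSpace ℝ (Fin n), heatKernel w 1 * g y := by
    rw [integral_mul_const, integral_heatKernel one_pos, one_mul]
  rw [h5]
  have hcont : ∀ c : ℝ, Continuous fun w : EuclideanSpace ℝ (Fin n) => g (y + c • w) :=
    fun c => hg.comp (by fun_prop)
  have hk : Continuous fun w : EuclideanSpace ℝ (Fin n) => heatKernel w 1 := by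
    simpa using continuous_heatKernel (0 : EuclideanSpace ℝ (Fin n)) 1
  refine tendsto_integral_filter_of_dominated_convergence (fun w => heatKernel w 1 * C)
    (Eventually.of_forall fun h => (hk.mul (hcont _)).aestronglyMeasurable)
    (Eventually.of_forall fun h => Eventually.of_forall fun w => ?_)
    ((integrable_heatKernel one_pos).mul_const C) (Eventually.of_forall fun w => ?_)
  · rw [norm_mul, Real.norm_of_nonneg (heatKernel_pos _ one_pos).le]
    exact mul_le_mul_of_nonneg_left (hC _) (heatKernel_pos _ one_pos).le
  · refine Tendsto.const_mul _ ?_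
    have h6 : Continuous fun h : ℝ => g (y + √h • w) := hg.comp (by fun_prop)
    have h7 := h6.tendsto 0
    simp only [sqrt_zero, zero_smul, add_zero] at h7
    exact h7.mono_left nhdsWithin_le_nhds

end KernelIntegral

/-! ### Cut-off functions -/

/-- `χ` is a `C²` cut-off, equal to `1` on the ball of radius `r` and to `0` off the ball of radius
`ρ`, whose gradient and Laplacian are bounded by `C`. -/
structure IsCutoff {n : ℕ} (χ : EuclideanSpace ℝ (Fin n) → ℝ) (r ρ C : ℝ) : Prop where
  contDiff : ContDiff ℝ 2 χ
  nonneg : ∀ z, 0 ≤ χ z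
  le_one : ∀ z, χ z ≤ 1
  eq_one : ∀ z, ‖z‖ < r → χ z = 1
  eq_zero : ∀ z, ρ < ‖z‖ → χ z = 0
  abs_lap_le : ∀ z, |lap χ z| ≤ C
  norm_fderiv_le : ∀ z, ‖fderiv ℝ χ z‖ ≤ C

section Cutoff

variable {n : ℕ} {χ : EuclideanSpace ℝ (Fin n) → ℝ} {r ρ C : ℝ}

lemma exists_isCutoff (n : ℕ) {r ρ : ℝ} (hr : 0 < r) (hρ : r < ρ) :
    ∃ (χ : EuclideanSpace ℝ (Fin n) → ℝ) (C : ℝ), IsCutoff χ r ρ C := by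
  let b : ContDiffBump (0 : EuclideanSpace ℝ (Fin n)) := ⟨r, ρ, hr, hρ⟩
  have hb : ContDiff ℝ 2 (b : EuclideanSpace ℝ (Fin n) → ℝ) := b.contDiff
  have hc : HasCompactSupport (b : EuclideanSpace ℝ (Fin n) → ℝ) := b.hasCompactSupport
  obtain ⟨C₁, hC₁⟩ := (hasCompactSupport_lap hc).exists_bound_of_continuous (continuous_lap hb)
  obtain ⟨C₂, hC₂⟩ := (hc.fderiv (𝕜 := ℝ)).exists_bound_of_continuous
    (hb.continuous_fderiv (by norm_num))
  refine ⟨b, max C₁ C₂, hb, fun z => b.nonneg, fun z => b.le_one, fun z hz => ?_, fun z hz => ?_,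
    fun z => (hC₁ z).trans (le_max_left _ _), fun z => (hC₂ z).trans (le_max_right _ _)⟩
  · exact b.one_of_mem_closedBall (by simpa using hz.le)
  · exact b.zero_of_le_dist (by simpa using hz.le)

lemma lap_comp_smul {f : EuclideanSpace ℝ (Fin n) → ℝ} (hf : ContDiff ℝ 2 f) (c : ℝ)
    (x : EuclideanSpace ℝ (Fin n)) : lap (fun z => f (c • z)) x = c ^ 2 * lap f (c • x) := by
  unfold lap
  rw [Finset.mul_sum]
  refine Finset.sum_congr rfl fun i _ => ?_
  set e : EuclideanSpace ℝ (Fin n) := EuclideanSpace.single i 1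
  have h1 : ∀ z, fderiv ℝ (fun z => f (c • z)) z e = c * fderiv ℝ f (c • z) e := fun z => by
    simp [fderiv_comp_smul]
  have h2 : DifferentiableAt ℝ (fun z => fderiv ℝ f z e) (c • x) :=
    (contDiff_fderiv_apply_const hf e).differentiable (by norm_num) _
  have h3 : DifferentiableAt ℝ (fun z => fderiv ℝ f (c • z) e) x :=
    h2.comp x (differentiableAt_id.const_smul c)
  simp_rw [h1]
  rw [fderiv_const_mul h3, fderiv_comp_smul (f := fun z => fderiv ℝ f z e)]
  simp
  ring

lemma exists_isCutoff_uniform (n : ℕ) :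
    ∃ C : ℝ, ∀ R : ℝ, 1 ≤ R → ∃ χ : EuclideanSpace ℝ (Fin n) → ℝ, IsCutoff χ R (2 * R) C := by
  obtain ⟨χ, C, hχ⟩ := exists_isCutoff n one_pos one_lt_two
  refine ⟨C, fun R hR => ⟨fun z => χ (R⁻¹ • z), ?_, fun z => hχ.nonneg _, fun z => hχ.le_one _,
    fun z hz => hχ.eq_one _ ?_, fun z hz => hχ.eq_zero _ ?_, fun z => ?_, fun z => ?_⟩⟩
  · exact hχ.contDiff.comp (contDiff_const_smul _)
  · rw [norm_smul, norm_inv, Real.norm_of_nonneg (by positivity), inv_mul_lt_iff₀ (by positivity)]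
    simpa using hz
  · rw [norm_smul, norm_inv, Real.norm_of_nonneg (by positivity), lt_inv_mul_iff₀ (by positivity)]
    linarith
  · have h1 : (R⁻¹) ^ 2 ≤ 1 := pow_le_one₀ (by positivity) (inv_le_one_of_one_le₀ hR)
    rw [lap_comp_smul hχ.contDiff, abs_mul, abs_of_nonneg (by positivity)]
    exact (mul_le_of_le_one_left (abs_nonneg _) h1).trans (hχ.abs_lap_le _)
  · rw [fderiv_comp_smul, norm_smul, norm_inv, Real.norm_of_nonneg (by positivity)]
    exact (mul_le_of_le_one_left (norm_nonneg _) (inv_le_one_of_one_le₀ hR)).trans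
      (hχ.norm_fderiv_le _)

lemma IsCutoff.hasCompactSupport (hχ : IsCutoff χ r ρ C) : HasCompactSupport χ :=
  HasCompactSupport.intro (isCompact_closedBall 0 ρ) fun z hz =>
    hχ.eq_zero z (by simpa using hz)

lemma IsCutoff.abs_le_one (hχ : IsCutoff χ r ρ C) (z : EuclideanSpace ℝ (Fin n)) : |χ z| ≤ 1 := by
  rw [abs_of_nonneg (hχ.nonneg z)]
  exact hχ.le_one z

lemma IsCutoff.const_nonneg (hχ : IsCutoff χ r ρ C) : 0 ≤ C :=
  (abs_nonneg _).trans (hχ.abs_lap_le 0)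

/-- A bound for the ratio of the commutator of a cut-off to the heat kernel at a later time. -/
def commutatorBound (n : ℕ) (C A d : ℝ) : ℝ :=
  C * (n + 1).factorial * ((4 * (A + 1) ^ 2 / d ^ 2) ^ n *
    (4 * (A + 1) ^ 2 / d ^ 2 + 4 * (A + 1) / d))

lemma commutatorBound_nonneg {A d : ℝ} (hC : 0 ≤ C) (hA : 0 ≤ A) (hd : 0 ≤ d) :
    0 ≤ commutatorBound n C A d := by
  unfold commutatorBound
  positivity

lemma tendsto_commutatorBound (n : ℕ) (C A : ℝ) :
    Tendsto (commutatorBound n C A) atTop (𝓝 0) := by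
  unfold commutatorBound
  have h1 : Tendsto (fun d : ℝ => 4 * (A + 1) ^ 2 / d ^ 2) atTop (𝓝 0) :=
    tendsto_const_nhds.div_atTop (tendsto_pow_atTop two_ne_zero)
  have h2 : Tendsto (fun d : ℝ => 4 * (A + 1) / d) atTop (𝓝 0) :=
    tendsto_const_nhds.div_atTop tendsto_id
  simpa using ((h1.pow n).mul (h1.add h2)).const_mul (C * (n + 1).factorial)

lemma heatKernel_eq_mul_heatKernel_add_one (w : EuclideanSpace ℝ (Fin n)) {h : ℝ} (hh : 0 < h) :
    heatKernel w h = ((h + 1) / h) ^ ((n : ℝ) / 2) * exp (-(‖w‖ ^ 2 / (4 * h * (h + 1)))) *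
      heatKernel w (h + 1) := by
  have h1 : exp (-‖w‖ ^ 2 / (4 * h)) =
      exp (-(‖w‖ ^ 2 / (4 * h * (h + 1)))) * exp (-‖w‖ ^ 2 / (4 * (h + 1))) := by
    rw [← exp_add]
    congr 1
    field_simp
    ring
  have h2 : (4 * π * h) ^ (-(n : ℝ) / 2) =
      ((h + 1) / h) ^ ((n : ℝ) / 2) * (4 * π * (h + 1)) ^ (-(n : ℝ) / 2) := by
    have h3 : 4 * π * h = ((h + 1) / h)⁻¹ * (4 * π * (h + 1)) := by field_simp
    rw [h3, mul_rpow (by positivity) (by positivity), neg_div, inv_rpow (by positivity),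
      rpow_neg (by positivity), inv_inv]
  unfold heatKernel
  rw [h1, h2]
  ring

lemma IsCutoff.abs_kernelCommutator_le (hχ : IsCutoff χ r ρ C) {y : EuclideanSpace ℝ (Fin n)}
    {A d h : ℝ} (hd : 0 < d) (hy : ‖y‖ + d ≤ r) (hh : 0 < h) (hA : h ≤ A)
    (z : EuclideanSpace ℝ (Fin n)) :
    |kernelCommutator χ y h z| ≤ commutatorBound n C A d * heatKernel (z - y) (h + 1) := by
  have hC := hχ.const_nonneg
  have hΦ := heatKernel_pos (z - y) (show 0 < h + 1 by positivity)
  have hA0 : 0 < A := hh.trans_le hA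
  rcases lt_or_ge ‖z - y‖ d with hz | hz
  · have h1 : χ =ᶠ[𝓝 z] fun _ => 1 := by
      have h2 : ‖z‖ < r := by
        have := norm_le_norm_sub_add z y
        linarith
      filter_upwards [(isOpen_lt continuous_norm continuous_const).mem_nhds h2] with w hw
      exact hχ.eq_one w hw
    have h3 : kernelCommutator χ y h z = 0 := by
      simp [kernelCommutator, lap_eq_zero_of_eventuallyEq h1, h1.fderiv_eq]
    rw [h3, abs_zero]
    exact mul_nonneg (commutatorBound_nonneg hC hA0.le hd.le) hΦ.le
  set w := z - y with hw
  set B := A + 1 with hB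
  have hB1 : 0 < B := by positivity
  have hw0 : 0 < ‖w‖ := hd.trans_le hz
  set v := ‖w‖ ^ 2 / (4 * h * B) with hv
  have hv0 : 0 ≤ v := by positivity
  have e1 : |lap χ z - fderiv ℝ χ z w / h| ≤ C * (4 * B ^ 2 / d ^ 2 + 4 * B / d) * v := by
    have h1 : |fderiv ℝ χ z w / h| ≤ C * (‖w‖ / h) := by
      rw [abs_div, abs_of_pos hh, ← mul_div_assoc]
      gcongr
      exact ((fderiv ℝ χ z).le_opNorm w).trans (by gcongr; exact hχ.norm_fderiv_le z)
    have h2 : 1 ≤ 4 * B ^ 2 / d ^ 2 * v := by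
      have : 4 * B ^ 2 / d ^ 2 * v = (‖w‖ / d) ^ 2 * (B / h) := by
        rw [hv]
        field_simp
      rw [this]
      refine one_le_mul_of_one_le_of_one_le (one_le_pow₀ ((one_le_div hd).2 hz)) ?_
      rw [one_le_div hh]
      linarith
    have h3 : ‖w‖ / h ≤ 4 * B / d * v := by
      have : 4 * B / d * v = ‖w‖ / h * (‖w‖ / d) := by
        rw [hv]
        field_simp
      rw [this]
      exact le_mul_of_one_le_right (by positivity) ((one_le_div hd).2 hz)
    calc |lap χ z - fderiv ℝ χ z w / h| ≤ |lap χ z| + |fderiv ℝ χ z w / h| := abs_sub _ _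
      _ ≤ C * (4 * B ^ 2 / d ^ 2 * v) + C * (4 * B / d * v) := by
        refine add_le_add ((hχ.abs_lap_le z).trans (le_mul_of_one_le_right hC h2))
          (h1.trans (by gcongr))
      _ = _ := by ring
  have e2 : ((h + 1) / h) ^ ((n : ℝ) / 2) ≤ (4 * B ^ 2 / d ^ 2 * v) ^ n := by
    have h1 : (1 : ℝ) ≤ (h + 1) / h := by rw [one_le_div hh]; linarith
    calc ((h + 1) / h) ^ ((n : ℝ) / 2) ≤ ((h + 1) / h) ^ (n : ℝ) :=
          rpow_le_rpow_of_exponent_le h1 (by linarith [(Nat.cast_nonneg n : (0 : ℝ) ≤ n)])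
      _ = ((h + 1) / h) ^ n := rpow_natCast _ _
      _ ≤ (4 * B ^ 2 / d ^ 2 * v) ^ n := by
        refine pow_le_pow_left₀ (by positivity) ?_ n
        have : 4 * B ^ 2 / d ^ 2 * v = (‖w‖ / d) ^ 2 * (B / h) := by
          rw [hv]
          field_simp
        rw [this]
        refine le_trans ?_ (le_mul_of_one_le_left (by positivity)
          (one_le_pow₀ ((one_le_div hd).2 hz)))
        gcongr
        linarith
  have e3 : exp (-(‖w‖ ^ 2 / (4 * h * (h + 1)))) ≤ exp (-v) := by
    rw [exp_le_exp, neg_le_neg_iff, hv]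
    gcongr
    linarith
  have e4 : v ^ (n + 1) * exp (-v) ≤ (n + 1).factorial := by
    have := pow_div_factorial_le_exp v hv0 (n + 1)
    rw [div_le_iff₀ (by positivity)] at this
    rw [exp_neg, mul_inv_le_iff₀ (exp_pos v)]
    linarith
  rw [kernelCommutator, abs_mul, ← hw, abs_of_pos (heatKernel_pos w hh),
    heatKernel_eq_mul_heatKernel_add_one w hh, ← mul_assoc]
  refine mul_le_mul_of_nonneg_right ?_ hΦ.le
  calc |lap χ z - fderiv ℝ χ z w / h| *
        (((h + 1) / h) ^ ((n : ℝ) / 2) * exp (-(‖w‖ ^ 2 / (4 * h * (h + 1)))))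
      ≤ (C * (4 * B ^ 2 / d ^ 2 + 4 * B / d) * v) *
        ((4 * B ^ 2 / d ^ 2 * v) ^ n * exp (-v)) := by gcongr
    _ = C * (4 * B ^ 2 / d ^ 2 + 4 * B / d) * (4 * B ^ 2 / d ^ 2) ^ n *
        (v ^ (n + 1) * exp (-v)) := by rw [mul_pow]; ring
    _ ≤ C * (4 * B ^ 2 / d ^ 2 + 4 * B / d) * (4 * B ^ 2 / d ^ 2) ^ n *
        (n + 1).factorial := by gcongr
    _ = commutatorBound n C A d := by unfold commutatorBound; ring

end Cutoff

/-! ### Weak supersolutions tested against compactly supported functions -/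

lemma le_of_forall_exists_right_growth {g : ℝ → ℝ} {a b : ℝ} (hab : a ≤ b)
    (hleft : ∀ t ∈ Ioc a b, ∀ ε > 0, ∀ᶠ s in 𝓝[<] t, g s ≤ g t + ε)
    (hright : ∀ s ∈ Ico a b, ∀ ε > 0, ∃ s' ∈ Ioc s b, g s - ε * (s' - s) ≤ g s') :
    g a ≤ g b := by
  suffices h : ∀ ε > 0, g a - ε * (b - a) ≤ g b by
    refine le_of_forall_pos_le_add fun ε hε => ?_
    have h1 := h (ε / (b - a + 1)) (by have := sub_nonneg.2 hab; positivity)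
    have h2 : ε / (b - a + 1) * (b - a) ≤ ε := by
      rw [div_mul_eq_mul_div, div_le_iff₀ (by linarith)]
      nlinarith
    linarith
  intro ε hε
  set A := {s ∈ Icc a b | g a - ε * (s - a) ≤ g s} with hA
  have haA : a ∈ A := ⟨⟨le_rfl, hab⟩, by simp⟩
  have hbdd : BddAbove A := ⟨b, fun s hs => hs.1.2⟩
  have hσ := isLUB_csSup ⟨a, haA⟩ hbdd
  set σ := sSup A
  have haσ : a ≤ σ := hσ.1 haA
  have hσb : σ ≤ b := hσ.2 fun s hs => hs.1.2
  have hσA : σ ∈ A := by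
    by_contra hn
    have hlt : a < σ := lt_of_le_of_ne haσ fun h => hn (h ▸ haA)
    refine hn ⟨⟨haσ, hσb⟩, le_of_forall_pos_le_add fun ε' hε' => ?_⟩
    obtain ⟨l, hl, hl'⟩ := (mem_nhdsLT_iff_exists_Ioo_subset' hlt).1
      (hleft σ ⟨hlt, hσb⟩ ε' hε')
    obtain ⟨s, hs, hls⟩ := (lt_isLUB_iff hσ).1 hl
    have hsσ : s < σ := lt_of_le_of_ne (hσ.1 hs) fun h => hn (h ▸ hs)
    have h1 := hl' ⟨hls, hsσ⟩
    have h2 := hs.2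
    simp only [mem_ofPred_eq] at h1
    nlinarith
  rcases hσb.eq_or_lt with h | h
  · exact h ▸ hσA.2
  · obtain ⟨s', hs', h1⟩ := hright σ ⟨haσ, h⟩ ε hε
    have h2 : s' ∈ A := ⟨⟨haσ.trans hs'.1.le, hs'.2⟩, by linarith [hσA.2]⟩
    exact absurd (hσ.1 h2) (not_le.2 hs'.1)

/-- Nonnegative test functions on `[c, d]`, with time derivative `ψ'`, supported in a ball of radius
less than `R`. -/
structure IsTest {n : ℕ} (R c d : ℝ) (ψ ψ' : EuclideanSpace ℝ (Fin n) → ℝ → ℝ) : Prop where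
  contDiff : ∀ s ∈ Icc c d, ContDiff ℝ 2 (fun z => ψ z s)
  hasDerivAt : ∀ z, ∀ s ∈ Icc c d, HasDerivAt (ψ z) (ψ' z s) s
  continuous_deriv : ∀ s ∈ Icc c d, Continuous (fun z => ψ' z s)
  nonneg : ∀ z, ∀ s ∈ Icc c d, 0 ≤ ψ z s
  bound : ∃ ρ C : ℝ, ρ < R ∧ ∀ z, ∀ s ∈ Icc c d,
    |ψ z s| ≤ (Metric.closedBall 0 ρ).indicator (fun _ => C) z ∧
    |ψ' z s| ≤ (Metric.closedBall 0 ρ).indicator (fun _ => C) z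

/-- `f` satisfies the integrated form of `lap f ≤ ∂ₛ f` on `[c, d]` for all test functions. -/
def WeakSuper {n : ℕ} (R : ℝ) (f : EuclideanSpace ℝ (Fin n) → ℝ → ℝ) (c d : ℝ) : Prop :=
  ∀ ψ ψ' : EuclideanSpace ℝ (Fin n) → ℝ → ℝ, IsTest R c d ψ ψ' → ∀ L : ℝ,
    (∀ s ∈ Icc c d, -L ≤ ∫ z, (ψ' z s + lap (fun z => ψ z s) z) * f z s) →
    (∫ z, ψ z c * f z c) - L * (d - c) ≤ ∫ z, ψ z d * f z d

/-- A separately regular function with `lap f ≤ ∂ₛ f = f'`, whose integrals against test functions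
do not jump downwards. -/
structure IsSupersolution {n : ℕ} (f f' : EuclideanSpace ℝ (Fin n) → ℝ → ℝ) : Prop where
  contDiff : ∀ s, 0 < s → ContDiff ℝ 2 (fun z => f z s)
  hasDerivAt : ∀ z s, 0 < s → HasDerivAt (f z) (f' z s) s
  continuous_deriv : ∀ s, 0 < s → Continuous (fun z => f' z s)
  continuousOn_deriv : ∀ z, ContinuousOn (f' z) (Ioi 0)
  lap_le : ∀ z s, 0 < s → lap (fun z => f z s) z ≤ f' z s
  left : ∀ {R c d : ℝ} {ψ ψ' : EuclideanSpace ℝ (Fin n) → ℝ → ℝ}, 0 < c → IsTest R c d ψ ψ' →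
    ∀ t ∈ Ioc c d, ∀ ε > 0, ∀ᶠ s in 𝓝[<] t, ∫ z, ψ z s * f z s ≤ (∫ z, ψ z t * f z t) + ε
  right : ∀ {R c d : ℝ} {ψ ψ' : EuclideanSpace ℝ (Fin n) → ℝ → ℝ}, 0 < c → IsTest R c d ψ ψ' →
    ∀ t ∈ Ico c d, ∀ ε > 0, ∀ᶠ s in 𝓝[>] t, ∫ z, ψ z t * f z t ≤ (∫ z, ψ z s * f z s) + ε
  bound : ∀ R a b : ℝ, 0 < a → ∃ M, ∀ s ∈ Icc a b, ∫ z in Metric.closedBall 0 R, |f z s| ≤ M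

section Test

variable {n : ℕ} {ψ ψ' f f' : EuclideanSpace ℝ (Fin n) → ℝ → ℝ} {R c d : ℝ}

lemma IsTest.mono (h : IsTest R c d ψ ψ') {c' d' : ℝ} (hc : c ≤ c') (hd : d' ≤ d) :
    IsTest R c' d' ψ ψ' := by
  have hs : Icc c' d' ⊆ Icc c d := Icc_subset_Icc hc hd
  obtain ⟨ρ, C, hρ, hb⟩ := h.bound
  exact ⟨fun s hs' => h.contDiff s (hs hs'), fun z s hs' => h.hasDerivAt z s (hs hs'),
    fun s hs' => h.continuous_deriv s (hs hs'), fun z s hs' => h.nonneg z s (hs hs'),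
    ρ, C, hρ, fun z s hs' => hb z s (hs hs')⟩

lemma hasCompactSupport_of_abs_le_indicator {g : EuclideanSpace ℝ (Fin n) → ℝ} {ρ C : ℝ}
    (h : ∀ z, |g z| ≤ (Metric.closedBall 0 ρ).indicator (fun _ => C) z) : HasCompactSupport g :=
  HasCompactSupport.intro (isCompact_closedBall 0 ρ) fun z hz => by
    have := h z
    rw [indicator_of_notMem hz] at this
    exact abs_nonpos_iff.1 this

lemma IsTest.hasCompactSupport (h : IsTest R c d ψ ψ') {s : ℝ} (hs : s ∈ Icc c d) :
    HasCompactSupport (fun z => ψ z s) := by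
  obtain ⟨ρ, C, -, hb⟩ := h.bound
  exact hasCompactSupport_of_abs_le_indicator fun z => (hb z s hs).1

lemma IsTest.hasCompactSupport_deriv (h : IsTest R c d ψ ψ') {s : ℝ} (hs : s ∈ Icc c d) :
    HasCompactSupport (fun z => ψ' z s) := by
  obtain ⟨ρ, C, -, hb⟩ := h.bound
  exact hasCompactSupport_of_abs_le_indicator fun z => (hb z s hs).2

lemma IsTest.continuous (h : IsTest R c d ψ ψ') {s : ℝ} (hs : s ∈ Icc c d) :
    Continuous (fun z => ψ z s) := (h.contDiff s hs).continuous

lemma IsTest.integrable_mul (h : IsTest R c d ψ ψ') {s : ℝ} (hs : s ∈ Icc c d)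
    {g : EuclideanSpace ℝ (Fin n) → ℝ} (hg : Continuous g) : Integrable (fun z => ψ z s * g z) :=
  integrable_mul_of_hasCompactSupport (h.continuous hs) hg (h.hasCompactSupport hs)

lemma IsTest.integrable_deriv_mul (h : IsTest R c d ψ ψ') {s : ℝ} (hs : s ∈ Icc c d)
    {g : EuclideanSpace ℝ (Fin n) → ℝ} (hg : Continuous g) : Integrable (fun z => ψ' z s * g z) :=
  integrable_mul_of_hasCompactSupport (h.continuous_deriv s hs) hg (h.hasCompactSupport_deriv hs)

lemma IsTest.integrable_lap_mul (h : IsTest R c d ψ ψ') {s : ℝ} (hs : s ∈ Icc c d)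
    {g : EuclideanSpace ℝ (Fin n) → ℝ} (hg : Continuous g) :
    Integrable (fun z => lap (fun z => ψ z s) z * g z) :=
  integrable_mul_of_hasCompactSupport (continuous_lap (h.contDiff s hs)) hg
    (hasCompactSupport_lap (h.hasCompactSupport hs))

lemma IsTest.integral_add_mul (h : IsTest R c d ψ ψ') {s : ℝ} (hs : s ∈ Icc c d)
    {g : EuclideanSpace ℝ (Fin n) → ℝ} (hg : Continuous g) :
    ∫ z, (ψ' z s + lap (fun z => ψ z s) z) * g z =
      (∫ z, ψ' z s * g z) + ∫ z, lap (fun z => ψ z s) z * g z := by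
  rw [← integral_add (h.integrable_deriv_mul hs hg) (h.integrable_lap_mul hs hg)]
  simp only [add_mul]

lemma integrable_indicator_closedBall_mul {g : EuclideanSpace ℝ (Fin n) → ℝ} (hg : Continuous g)
    (ρ C : ℝ) :
    Integrable (fun z => (Metric.closedBall 0 ρ).indicator (fun _ => C) z * g z) := by
  have h1 : (fun z => (Metric.closedBall 0 ρ).indicator (fun _ => C) z * g z) =
      (Metric.closedBall 0 ρ).indicator (fun z => C * g z) := by
    funext z
    exact (indicator_mul_left _ _ _).symm
  rw [h1, integrable_indicator_iff measurableSet_closedBall]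
  exact (hg.const_mul C).continuousOn.integrableOn_compact (isCompact_closedBall 0 ρ)

/-- Integrals of a fixed function against a test function grow at most at the rate given by the
time derivative of the test function. -/
lemma IsTest.integral_mul_le (h : IsTest R c d ψ ψ') (hcd : c ≤ d)
    {g : EuclideanSpace ℝ (Fin n) → ℝ} (hg : Continuous g) {K : ℝ}
    (hK : ∀ s ∈ Icc c d, ∫ z, ψ' z s * g z ≤ K) :
    (∫ z, ψ z d * g z) - ∫ z, ψ z c * g z ≤ K * (d - c) := by
  obtain ⟨ρ, C, -, hb⟩ := h.bound
  have hgi := integrable_indicator_closedBall_mul hg.abs ρ C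
  have hle : ∀ {u : EuclideanSpace ℝ (Fin n) → ℝ} {z : EuclideanSpace ℝ (Fin n)},
      |u z| ≤ (Metric.closedBall 0 ρ).indicator (fun _ => C) z →
      ‖u z * g z‖ ≤ (Metric.closedBall 0 ρ).indicator (fun _ => C) z * |g z| := by
    intro u z hu
    rw [Real.norm_eq_abs, abs_mul]
    exact mul_le_mul_of_nonneg_right hu (abs_nonneg _)
  have hcont : ContinuousOn (fun s => ∫ z, ψ z s * g z) (Icc c d) := by
    intro s hs
    refine tendsto_integral_filter_of_dominated_convergence _
      (eventually_nhdsWithin_of_forall fun t ht => (h.integrable_mul ht hg).aestronglyMeasurable)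
      (eventually_nhdsWithin_of_forall fun t ht => Eventually.of_forall fun z =>
        hle (u := fun z => ψ z t) (hb z t ht).1) hgi
      (Eventually.of_forall fun z => ?_)
    exact (((h.hasDerivAt z s hs).continuousAt.tendsto).mono_left nhdsWithin_le_nhds).mul_const _
  have hderiv : ∀ s ∈ Ioo c d,
      HasDerivAt (fun s => ∫ z, ψ z s * g z) (∫ z, ψ' z s * g z) s := by
    intro s hs
    have hs' := Ioo_subset_Icc_self hs
    have hd : ∀ z, ∀ t ∈ Ioo c d, HasDerivAt (fun t => ψ z t * g z) (ψ' z t * g z) t :=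
      fun z t ht => (h.hasDerivAt z t (Ioo_subset_Icc_self ht)).mul_const (g z)
    refine (hasDerivAt_integral_of_dominated_loc_of_deriv_le (F := fun t z => ψ z t * g z)
      (F' := fun t z => ψ' z t * g z) (Ioo_mem_nhds hs.1 hs.2) ?_ (h.integrable_mul hs' hg)
      (h.integrable_deriv_mul hs' hg).aestronglyMeasurable (Eventually.of_forall fun z t ht =>
        hle (u := fun z => ψ' z t) (hb z t (Ioo_subset_Icc_self ht)).2) hgi
      (Eventually.of_forall hd)).2
    filter_upwards [Ioo_mem_nhds hs.1 hs.2] with t ht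
    exact (h.integrable_mul (Ioo_subset_Icc_self ht) hg).aestronglyMeasurable
  refine Convex.image_sub_le_mul_sub_of_deriv_le (convex_Icc c d) hcont ?_ ?_ c ⟨le_rfl, hcd⟩ d
    ⟨hcd, le_rfl⟩ hcd
  · rw [interior_Icc]
    exact fun s hs => (hderiv s hs).differentiableAt.differentiableWithinAt
  · rw [interior_Icc]
    intro s hs
    rw [(hderiv s hs).deriv]
    exact hK s (Ioo_subset_Icc_self hs)

lemma IsSupersolution.continuous (hf : IsSupersolution f f') {s : ℝ} (hs : 0 < s) :
    Continuous (fun z => f z s) := (hf.contDiff s hs).continuous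

lemma IsSupersolution.integral_le_of_right_growth (hf : IsSupersolution f f') (hc : 0 < c)
    (hcd : c ≤ d) (hψ : IsTest R c d ψ ψ') {L : ℝ}
    (h : ∀ s ∈ Ico c d, ∀ ε > 0, ∃ s' ∈ Ioc s d,
      (∫ z, ψ z s * f z s) - (L + ε) * (s' - s) ≤ ∫ z, ψ z s' * f z s') :
    (∫ z, ψ z c * f z c) - L * (d - c) ≤ ∫ z, ψ z d * f z d := by
  have h1 := le_of_forall_exists_right_growth (g := fun s => (∫ z, ψ z s * f z s) + L * s) hcd
    (fun t ht ε hε => ?_) fun s hs ε hε => ?_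
  · linarith
  · have h2 : ∀ᶠ s in 𝓝[<] t, L * s < L * t + ε / 2 := by
      have : Tendsto (fun s => L * s) (𝓝[<] t) (𝓝 (L * t)) :=
        ((continuous_const_mul L).tendsto t).mono_left nhdsWithin_le_nhds
      exact this.eventually_lt_const (by linarith)
    filter_upwards [h2, hf.left hc hψ t ht (ε / 2) (by linarith)] with s h3 h4
    linarith
  · obtain ⟨s', hs', h2⟩ := h s hs ε hε
    exact ⟨s', hs', by linarith⟩

/-- `f` is a weak supersolution on all short enough subintervals of `[c, d]` near `s`. -/
def LocallyWeakSuper (R : ℝ) (f : EuclideanSpace ℝ (Fin n) → ℝ → ℝ) (c d s : ℝ) : Prop :=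
  ∃ δ > 0, ∀ c' d', c ≤ c' → c' < d' → d' ≤ d → s - δ < c' → d' < s + δ → WeakSuper R f c' d'

lemma LocallyWeakSuper.exists_growth {s : ℝ} (hs : s ∈ Ico c d) (h : LocallyWeakSuper R f c d s)
    (hψ : IsTest R c d ψ ψ') {L : ℝ}
    (hL : ∀ s ∈ Icc c d, -L ≤ ∫ z, (ψ' z s + lap (fun z => ψ z s) z) * f z s) {ε : ℝ}
    (hε : 0 < ε) : ∃ s' ∈ Ioc s d,
      (∫ z, ψ z s * f z s) - (L + ε) * (s' - s) ≤ ∫ z, ψ z s' * f z s' := by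
  obtain ⟨δ, hδ, hw⟩ := h
  have h1 : s < min (s + δ / 2) d := lt_min (by linarith) hs.2
  refine ⟨min (s + δ / 2) d, ⟨h1, min_le_right _ _⟩, ?_⟩
  have h2 := hw s (min (s + δ / 2) d) hs.1 h1 (min_le_right _ _) (by linarith)
    ((min_le_left _ _).trans_lt (by linarith)) ψ ψ' (hψ.mono hs.1 (min_le_right _ _)) L
    fun t ht => hL t ⟨hs.1.trans ht.1, ht.2.trans (min_le_right _ _)⟩
  nlinarith

lemma IsSupersolution.weakSuper_of_locally (hf : IsSupersolution f f') (hc : 0 < c) (hcd : c ≤ d)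
    (h : ∀ s ∈ Icc c d, LocallyWeakSuper R f c d s) : WeakSuper R f c d := by
  intro ψ ψ' hψ L hL
  exact hf.integral_le_of_right_growth hc hcd hψ fun s hs ε hε =>
    (h s (Ico_subset_Icc_self hs)).exists_growth hs hψ hL hε

lemma IsSupersolution.weakSuper_of_Ioo (hf : IsSupersolution f f') (hc : 0 < c) (hcd : c < d)
    (h : ∀ c' d', c < c' → c' < d' → d' < d → WeakSuper R f c' d') : WeakSuper R f c d := by
  intro ψ ψ' hψ L hL
  refine le_of_forall_pos_le_add fun ε hε => ?_
  have h1 := hf.right hc hψ c ⟨le_rfl, hcd⟩ (ε / 3) (by linarith)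
  have h2 := hf.left hc hψ d ⟨hcd, le_rfl⟩ (ε / 3) (by linarith)
  have h3 : ∀ᶠ s in 𝓝[>] c, |L| * (s - c) < ε / 6 := by
    have : Tendsto (fun s => |L| * (s - c)) (𝓝[>] c) (𝓝 (|L| * (c - c))) :=
      (Continuous.tendsto (by fun_prop) c).mono_left nhdsWithin_le_nhds
    exact this.eventually_lt_const (by simp; linarith)
  have h4 : ∀ᶠ s in 𝓝[<] d, |L| * (d - s) < ε / 6 := by
    have : Tendsto (fun s => |L| * (d - s)) (𝓝[<] d) (𝓝 (|L| * (d - d))) :=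
      (Continuous.tendsto (by fun_prop) d).mono_left nhdsWithin_le_nhds
    exact this.eventually_lt_const (by simp; linarith)
  have hm1 : c < (c + d) / 2 := by linarith
  have hm2 : (c + d) / 2 < d := by linarith
  obtain ⟨c', ⟨h5, h6⟩, hc'⟩ := ((h1.and h3).and (Ioo_mem_nhdsGT hm1)).exists
  obtain ⟨d', ⟨h7, h8⟩, hd'⟩ := ((h2.and h4).and (Ioo_mem_nhdsLT hm2)).exists
  have h9 := h c' d' hc'.1 (hc'.2.trans hd'.1) hd'.2 ψ ψ' (hψ.mono hc'.1.le hd'.2.le) L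
    fun s hs => hL s ⟨hc'.1.le.trans hs.1, hs.2.trans hd'.2.le⟩
  have h10 : -(L * (c' - c)) ≤ |L| * (c' - c) := by
    nlinarith [neg_abs_le L, hc'.1]
  have h11 : -(L * (d - d')) ≤ |L| * (d - d') := by
    nlinarith [neg_abs_le L, hd'.2]
  linarith

end Test

/-! ### Separately regular supersolutions are weak supersolutions -/

section HeatTest

variable {n : ℕ} {f f' : EuclideanSpace ℝ (Fin n) → ℝ → ℝ} {R c d : ℝ}
  {χ : EuclideanSpace ℝ (Fin n) → ℝ} {r ρ C : ℝ}

lemma IsCutoff.abs_mul_le_indicator (hχ : IsCutoff χ r ρ C) {z : EuclideanSpace ℝ (Fin n)}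
    {u B : ℝ} (hu : ‖z‖ ≤ ρ → |u| ≤ B) :
    |χ z * u| ≤ (Metric.closedBall 0 ρ).indicator (fun _ => B) z := by
  by_cases hz : ‖z‖ ≤ ρ
  · rw [indicator_of_mem (by simpa using hz), abs_mul]
    exact (mul_le_of_le_one_left (abs_nonneg _) (hχ.abs_le_one z)).trans (hu hz)
  · rw [indicator_of_notMem (by simpa using hz), hχ.eq_zero z (not_le.1 hz)]
    simp

/-- Truncated backward heat kernels are test functions. -/
lemma IsCutoff.isTest (hχ : IsCutoff χ r ρ C) (hρ : ρ < R) {T : ℝ} (hT : d < T)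
    (y : EuclideanSpace ℝ (Fin n)) :
    IsTest R c d (fun z s => χ z * heatKernel (z - y) (T - s))
      (fun z s => -(χ z * ((‖z - y‖ ^ 2 / (4 * (T - s) ^ 2) - n / (2 * (T - s))) *
        heatKernel (z - y) (T - s)))) := by
  have hpos : ∀ s ∈ Icc c d, 0 < T - s := fun s hs => by linarith [hs.2]
  set δ := T - d with hδ
  have hδ0 : 0 < δ := by linarith
  set P := (4 * π * δ) ^ (-(n : ℝ) / 2) with hP
  have hP0 : 0 < P := by positivity
  have hΦ : ∀ z, ∀ s ∈ Icc c d, |heatKernel (z - y) (T - s)| ≤ P := fun z s hs => by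
    rw [abs_of_pos (heatKernel_pos _ (hpos s hs))]
    refine (heatKernel_le _ (hpos s hs)).trans ?_
    refine rpow_le_rpow_of_nonpos (by positivity) ?_ ?_
    · have : δ ≤ T - s := by linarith [hs.2]
      gcongr
    · rw [neg_div]
      exact neg_nonpos.2 (by positivity)
  set Q := ((ρ + ‖y‖) ^ 2 / (4 * δ ^ 2) + n / (2 * δ)) with hQ
  have hQ0 : 0 ≤ Q := by positivity
  refine ⟨fun s hs => hχ.contDiff.mul (contDiff_heatKernel y _), fun z s hs => ?_, fun s hs => ?_,
    fun z s hs => mul_nonneg (hχ.nonneg z) (heatKernel_pos _ (hpos s hs)).le, ρ, max P (Q * P), hρ,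
    fun z s hs => ⟨?_, ?_⟩⟩
  · have h1 := (hasDerivAt_heatKernel (z - y) (hpos s hs)).comp s ((hasDerivAt_id s).const_sub T)
    refine (h1.const_mul (χ z)).congr_deriv ?_
    ring
  · have h1 := hχ.contDiff.continuous
    have h2 := continuous_heatKernel y (T - s)
    fun_prop
  · exact hχ.abs_mul_le_indicator fun _ => (hΦ z s hs).trans (le_max_left _ _)
  · rw [abs_neg]
    refine hχ.abs_mul_le_indicator fun hz => le_max_of_le_right ?_
    rw [abs_mul]
    refine mul_le_mul ?_ (hΦ z s hs) (abs_nonneg _) hQ0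
    have h3 : δ ≤ T - s := by linarith [hs.2]
    have h4 : 0 < T - s := hpos s hs
    have h5 : ‖z - y‖ ≤ ρ + ‖y‖ := (norm_sub_le z y).trans (by gcongr)
    have h6 : ‖z - y‖ ^ 2 / (4 * (T - s) ^ 2) ≤ (ρ + ‖y‖) ^ 2 / (4 * δ ^ 2) := by gcongr
    have h7 : (n : ℝ) / (2 * (T - s)) ≤ n / (2 * δ) := by gcongr
    have h8 : 0 ≤ ‖z - y‖ ^ 2 / (4 * (T - s) ^ 2) := by positivity
    have h9 : 0 ≤ (n : ℝ) / (2 * (T - s)) := by positivity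
    rw [abs_le, hQ]
    constructor <;> linarith

lemma IsCutoff.heat_operator_eq (hχ : IsCutoff χ r ρ C) {T s : ℝ} (hT : s < T)
    (y z : EuclideanSpace ℝ (Fin n)) :
    -(χ z * ((‖z - y‖ ^ 2 / (4 * (T - s) ^ 2) - n / (2 * (T - s))) *
        heatKernel (z - y) (T - s))) + lap (fun z => χ z * heatKernel (z - y) (T - s)) z =
      kernelCommutator χ y (T - s) z :=
  lap_mul_heatKernel hχ.contDiff y z (by linarith)

lemma IsCutoff.kernelCommutator_eq_zero (hχ : IsCutoff χ r ρ C) {y z : EuclideanSpace ℝ (Fin n)}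
    {h : ℝ} (hz : ρ < ‖z‖) : kernelCommutator χ y h z = 0 := by
  have h1 : χ =ᶠ[𝓝 z] fun _ => 0 := by
    filter_upwards [(isOpen_lt continuous_const continuous_norm).mem_nhds hz] with w hw
    exact hχ.eq_zero w hw
  simp [kernelCommutator, lap_eq_zero_of_eventuallyEq h1, h1.fderiv_eq]

lemma IsCutoff.abs_integral_kernelCommutator_mul_le (hχ : IsCutoff χ r ρ C) (hρ : ρ ≤ R)
    {y : EuclideanSpace ℝ (Fin n)} {A e h : ℝ} (he : 0 < e) (hy : ‖y‖ + e ≤ r) (hh : 0 < h)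
    (hA : h ≤ A) {g : EuclideanSpace ℝ (Fin n) → ℝ} (hg : Continuous g) :
    |∫ z, kernelCommutator χ y h z * g z| ≤
      commutatorBound n C A e * ∫ z in Metric.closedBall 0 R, |g z| := by
  have hcb : 0 ≤ commutatorBound n C A e :=
    commutatorBound_nonneg hχ.const_nonneg (hh.le.trans hA) he.le
  rw [← integral_indicator measurableSet_closedBall, ← integral_const_mul]
  have hgi : IntegrableOn (fun z => |g z|) (Metric.closedBall 0 R) :=
    hg.abs.continuousOn.integrableOn_compact (isCompact_closedBall 0 R)
  rw [← Real.norm_eq_abs]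
  refine norm_integral_le_of_norm_le
    (((integrable_indicator_iff measurableSet_closedBall).2 hgi).const_mul _)
    (Eventually.of_forall fun z => ?_)
  rw [norm_mul, Real.norm_eq_abs, Real.norm_eq_abs]
  by_cases hz : ‖z‖ ≤ R
  · rw [indicator_of_mem (by simpa using hz)]
    refine mul_le_mul_of_nonneg_right ?_ (abs_nonneg _)
    refine (hχ.abs_kernelCommutator_le he hy hh hA z).trans (mul_le_of_le_one_right hcb ?_)
    refine (heatKernel_le _ (by linarith)).trans (rpow_le_one_of_one_le_of_nonpos ?_ ?_)
    · nlinarith [pi_gt_three]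
    · rw [neg_div]
      exact neg_nonpos.2 (by positivity)
  · rw [hχ.kernelCommutator_eq_zero (hρ.trans_lt (not_le.1 hz)), abs_zero, zero_mul]
    exact mul_nonneg hcb (indicator_nonneg (fun _ _ => abs_nonneg _) _)

lemma tendsto_sub_nhdsGT (t : ℝ) : Tendsto (fun T => T - t) (𝓝[>] t) (𝓝[>] 0) := by
  refine tendsto_nhdsWithin_iff.2 ⟨?_, eventually_nhdsWithin_of_forall fun T hT =>
    mem_Ioi.2 (sub_pos.2 hT)⟩
  have := (continuous_sub_right t).tendsto t
  rw [sub_self] at this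
  exact this.mono_left nhdsWithin_le_nhds

lemma IsCutoff.tendsto_integral (hχ : IsCutoff χ r ρ C) {y : EuclideanSpace ℝ (Fin n)}
    (hy : ‖y‖ < r) {g : EuclideanSpace ℝ (Fin n) → ℝ} (hg : Continuous g) (b : ℝ) :
    Tendsto (fun T => ∫ z, χ z * heatKernel (z - y) (T - b) * g z) (𝓝[>] b) (𝓝 (g y)) := by
  have hc : Continuous fun z => χ z * g z := hχ.contDiff.continuous.mul hg
  obtain ⟨B, hB⟩ := (HasCompactSupport.mul_right hχ.hasCompactSupport
    (f' := g)).exists_bound_of_continuous hc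
  have h1 := tendsto_integral_heatKernel_mul y hc hB
  rw [hχ.eq_one y hy, one_mul] at h1
  refine (h1.comp (tendsto_sub_nhdsGT b)).congr fun T => ?_
  simp only [Function.comp]
  congr 1
  funext z
  ring

/-- Lower bounds on a time slice, stated so that they persist under limits in time. -/
structure SliceBound (R : ℝ) (f f' : EuclideanSpace ℝ (Fin n) → ℝ → ℝ) (k t : ℝ) : Prop where
  abs_le : ∀ z, ‖z‖ ≤ R → |f z t| ≤ k
  deriv_ge : ∀ z, ‖z‖ ≤ R → -k ≤ f' z t
  lap_ge : ∀ χ : EuclideanSpace ℝ (Fin n) → ℝ, ContDiff ℝ 2 χ → (∀ z, 0 ≤ χ z) →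
    (∃ ρ < R, ∀ z, ρ < ‖z‖ → χ z = 0) → -k * ∫ z, χ z ≤ ∫ z, lap χ z * f z t

lemma IsSupersolution.sub_le_of_weakSuper (hf : IsSupersolution f f') (hχ : IsCutoff χ r ρ C)
    (hρ : ρ < R) {y : EuclideanSpace ℝ (Fin n)} {A a b e k M : ℝ} (he : 0 < e) (hy : ‖y‖ + e ≤ r)
    (ha : 0 < a) (hab : a < b) (hA : b - a + 1 ≤ A) (hk : 0 ≤ k)
    (hM : ∀ s ∈ Icc a b, ∫ z in Metric.closedBall 0 R, |f z s| ≤ M)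
    (ha' : SliceBound R f f' k a) (hw : WeakSuper R f a b) :
    f y a - (2 * (commutatorBound n C A e * M) + k) * (b - a) ≤ f y b := by
  have hcb : 0 ≤ commutatorBound n C A e :=
    commutatorBound_nonneg hχ.const_nonneg (by linarith) he.le
  have hy' : ‖y‖ < r := by linarith
  have hcomm : ∀ T ∈ Ioo b (b + 1), ∀ s ∈ Icc a b, ∀ t ∈ Icc a b,
      |∫ z, kernelCommutator χ y (T - s) z * f z t| ≤ commutatorBound n C A e * M := by
    intro T hT s hs t ht
    refine (hχ.abs_integral_kernelCommutator_mul_le hρ.le he hy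
      (show 0 < T - s by linarith [hs.2, hT.1]) (show T - s ≤ A by linarith [hs.1, hT.2])
      (hf.continuous (ha.trans_le ht.1))).trans ?_
    exact mul_le_mul_of_nonneg_left (hM t ht) hcb
  have key : ∀ T ∈ Ioo b (b + 1),
      (∫ z, χ z * heatKernel (z - y) (T - b) * f z a) -
        (2 * (commutatorBound n C A e * M) + k) * (b - a) ≤
      ∫ z, χ z * heatKernel (z - y) (T - b) * f z b := by
    intro T hT
    have htest := hχ.isTest (c := a) (d := b) hρ hT.1 y
    have h1 := hw _ _ htest (commutatorBound n C A e * M) fun s hs => by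
      simp_rw [hχ.heat_operator_eq (hs.2.trans_lt hT.1)]
      exact neg_le_of_abs_le (hcomm T hT s hs s hs)
    have h2 := htest.integral_mul_le hab.le (hf.continuous ha)
      (K := commutatorBound n C A e * M + k) fun s hs => by
      have h3 := htest.integral_add_mul hs (hf.continuous ha)
      simp_rw [hχ.heat_operator_eq (hs.2.trans_lt hT.1)] at h3
      have h4 := ha'.lap_ge (fun z => χ z * heatKernel (z - y) (T - s)) (htest.contDiff s hs)
        (fun z => htest.nonneg z s hs) ⟨ρ, hρ, fun z hz => by rw [hχ.eq_zero z hz, zero_mul]⟩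
      have h5 := le_of_abs_le (hcomm T hT s hs a ⟨le_rfl, hab.le⟩)
      have h6 : ∫ z, χ z * heatKernel (z - y) (T - s) ≤ 1 := by
        have hTs : 0 < T - s := by linarith [hs.2, hT.1]
        have h61 := htest.integrable_mul hs (continuous_const (y := (1 : ℝ)))
        simp only [mul_one] at h61
        refine (integral_mono h61 (integrable_heatKernel_sub y hTs) fun z =>
          mul_le_of_le_one_left (heatKernel_pos _ hTs).le (hχ.le_one z)).trans_eq
          (integral_heatKernel_sub y hTs)
      nlinarith
    linarith
  refine le_of_tendsto_of_tendsto ((hχ.tendsto_integral hy' (hf.continuous ha) b).sub_const _)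
    (hχ.tendsto_integral hy' (hf.continuous (ha.trans hab)) b) ?_
  filter_upwards [Ioo_mem_nhdsGT (show b < b + 1 by linarith)] with T hT using key T hT

end HeatTest

section Baire

variable {n : ℕ} {ψ ψ' f f' : EuclideanSpace ℝ (Fin n) → ℝ → ℝ} {R c d : ℝ}

/-- A slice from which `f` grows at most linearly downwards contributes the right growth. -/
lemma IsSupersolution.eventually_growth (hf : IsSupersolution f f') (hc : 0 < c)
    (hψ : IsTest R c d ψ ψ') {s : ℝ} (hs : s ∈ Ico c d)
    (hlip : ∀ ρ < R, ∃ K, ∀ z, ‖z‖ ≤ ρ → ∀ s' ∈ Ioc s d, f z s - K * (s' - s) ≤ f z s')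
    {ε : ℝ} (hε : 0 < ε) : ∀ᶠ s' in 𝓝[>] s, (∫ z, ψ z s * f z s) +
      ((∫ z, (ψ' z s + lap (fun z => ψ z s) z) * f z s) - ε) * (s' - s) ≤
      ∫ z, ψ z s' * f z s' := by
  obtain ⟨ρ, C, hρ, hb⟩ := hψ.bound
  obtain ⟨K, hK⟩ := hlip ρ hρ
  have hs' := Ico_subset_Icc_self hs
  have hs0 : 0 < s := hc.trans_le hs.1
  have hIoc : Ioc s d ∈ 𝓝[>] s := Ioc_mem_nhdsGT hs.2
  set Q : ℝ → EuclideanSpace ℝ (Fin n) → ℝ :=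
    fun t z => (t - s)⁻¹ * (ψ z t * f z t - ψ z s * f z s) with hQ
  set D : EuclideanSpace ℝ (Fin n) → ℝ := fun z => ψ' z s * f z s + ψ z s * f' z s with hD
  set bd : EuclideanSpace ℝ (Fin n) → ℝ := fun z =>
    (Metric.closedBall 0 ρ).indicator (fun _ => C) z * (|K| + |f z s|) with hbd
  have hDi : Integrable D := (hψ.integrable_deriv_mul hs' (hf.continuous hs0)).add
    (hψ.integrable_mul hs' (hf.continuous_deriv s hs0))
  have hbi : Integrable bd :=
    integrable_indicator_closedBall_mul (continuous_const.add (hf.continuous hs0).abs) ρ C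
  have hmem : ∀ t ∈ Ioc s d, t ∈ Icc c d := fun t ht => ⟨hs.1.trans ht.1.le, ht.2⟩
  have hQi : ∀ t ∈ Ioc s d, Integrable (Q t) := fun t ht =>
    ((hψ.integrable_mul (hmem t ht) (hf.continuous (hs0.trans ht.1))).sub
      (hψ.integrable_mul hs' (hf.continuous hs0))).const_mul _
  have hψlip : ∀ z, ∀ t ∈ Ioc s d, |ψ z t - ψ z s| ≤
      (Metric.closedBall 0 ρ).indicator (fun _ => C) z * (t - s) := fun z t ht => by
    have := Convex.norm_image_sub_le_of_norm_hasDerivWithin_le (f := ψ z) (f' := ψ' z)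
      (s := Icc c d) (fun u hu => (hψ.hasDerivAt z u hu).hasDerivWithinAt)
      (fun u hu => (hb z u hu).2) (convex_Icc c d) hs' (hmem t ht)
    rwa [Real.norm_eq_abs, Real.norm_eq_abs, abs_of_pos (sub_pos.2 ht.1)] at this
  have hQlow : ∀ t ∈ Ioc s d, ∀ z, -bd z ≤ Q t z := by
    intro t ht z
    have hts : 0 < t - s := sub_pos.2 ht.1
    have h1 : -(bd z * (t - s)) ≤ ψ z t * f z t - ψ z s * f z s := by
      have e1 : ψ z t * f z t - ψ z s * f z s =
          ψ z t * (f z t - f z s) + (ψ z t - ψ z s) * f z s := by ring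
      have h2 := hψlip z t ht
      have h3 := (hb z t (hmem t ht)).1
      have h4 := hψ.nonneg z t (hmem t ht)
      have h5 : -((Metric.closedBall 0 ρ).indicator (fun _ => C) z * (t - s) * |f z s|) ≤
          (ψ z t - ψ z s) * f z s := by
        refine neg_le_of_abs_le ?_
        rw [abs_mul]
        exact mul_le_mul_of_nonneg_right h2 (abs_nonneg _)
      have h6 : -((Metric.closedBall 0 ρ).indicator (fun _ => C) z * (|K| * (t - s))) ≤
          ψ z t * (f z t - f z s) := by
        by_cases hz : ‖z‖ ≤ ρ
        · have h7 := hK z hz t ht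
          have h8 : -(|K| * (t - s)) ≤ f z t - f z s := by
            nlinarith [le_abs_self K]
          have h9 := mul_le_mul_of_nonneg_left h8 h4
          rw [abs_of_nonneg h4] at h3
          nlinarith [mul_le_mul_of_nonneg_right h3 (show 0 ≤ |K| * (t - s) by positivity)]
        · rw [indicator_of_notMem (by simpa using hz)] at h3 ⊢
          rw [abs_nonpos_iff.1 h3]
          simp
      rw [e1, hbd]
      simp only
      nlinarith
    rw [hQ]
    simp only
    rw [← div_eq_inv_mul, le_div_iff₀ hts]
    linarith
  have hQD : ∀ z, Tendsto (fun t => Q t z) (𝓝[>] s) (𝓝 (D z)) := fun z => by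
    have h1 : HasDerivAt (fun t => ψ z t * f z t) (D z) s :=
      (hψ.hasDerivAt z s hs').mul (hf.hasDerivAt z s hs0)
    have h2 := (hasDerivWithinAt_iff_tendsto_slope.1 (h1.hasDerivWithinAt (s := Ioi s)))
    rw [sdiff_singleton_eq_self (by simp)] at h2
    refine h2.congr fun t => ?_
    simp [slope, hQ]
  have hlim : Tendsto (fun t => ∫ z, min (Q t z) (D z)) (𝓝[>] s) (𝓝 (∫ z, D z)) := by
    refine tendsto_integral_filter_of_dominated_convergence (fun z => bd z + |D z|) ?_ ?_
      (hbi.add hDi.abs) (Eventually.of_forall fun z => ?_)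
    · filter_upwards [hIoc] with t ht using ((hQi t ht).inf hDi).aestronglyMeasurable
    · filter_upwards [hIoc] with t ht
      refine Eventually.of_forall fun z => ?_
      have h1 := hQlow t ht z
      have hbd0 : 0 ≤ bd z := by
        have := (abs_nonneg _).trans (hb z s hs').1
        rw [hbd]
        positivity
      rw [Real.norm_eq_abs, abs_le]
      constructor
      · refine le_min ?_ ?_
        · linarith [abs_nonneg (D z)]
        · linarith [neg_abs_le (D z)]
      · exact (min_le_right _ _).trans (by linarith [le_abs_self (D z)])
    · simpa using (hQD z).min (tendsto_const_nhds (x := D z))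
  have hDH : ∫ z, (ψ' z s + lap (fun z => ψ z s) z) * f z s ≤ ∫ z, D z := by
    rw [hψ.integral_add_mul hs' (hf.continuous hs0),
      ← integral_mul_lap (hψ.contDiff s hs') (hψ.hasCompactSupport hs') (hf.contDiff s hs0),
      hD, integral_add (hψ.integrable_deriv_mul hs' (hf.continuous hs0))
        (hψ.integrable_mul hs' (hf.continuous_deriv s hs0))]
    refine add_le_add_right (integral_mono
      (hψ.integrable_mul hs' (continuous_lap (hf.contDiff s hs0)))
      (hψ.integrable_mul hs' (hf.continuous_deriv s hs0)) fun z => ?_) _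
    exact mul_le_mul_of_nonneg_left (hf.lap_le z s hs0) (hψ.nonneg z s hs')
  filter_upwards [hlim.eventually_const_lt (show (∫ z, D z) - ε < ∫ z, D z by linarith), hIoc]
    with t h1 ht
  have hts : 0 < t - s := sub_pos.2 ht.1
  have h2 : ∫ z, min (Q t z) (D z) ≤ ∫ z, Q t z :=
    integral_mono ((hQi t ht).inf hDi) (hQi t ht) fun z => min_le_left _ _
  have h3 : ∫ z, Q t z = (t - s)⁻¹ * ((∫ z, ψ z t * f z t) - ∫ z, ψ z s * f z s) := by
    rw [hQ]
    simp only
    rw [integral_const_mul, integral_sub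
      (hψ.integrable_mul (hmem t ht) (hf.continuous (hs0.trans ht.1)))
      (hψ.integrable_mul hs' (hf.continuous hs0))]
  have h4 : (∫ z, (ψ' z s + lap (fun z => ψ z s) z) * f z s) - ε ≤
      ((∫ z, ψ z t * f z t) - ∫ z, ψ z s * f z s) / (t - s) := by
    rw [div_eq_inv_mul, ← h3]
    linarith
  rw [le_div_iff₀ hts] at h4
  linarith

end Baire

section Baire

variable {n : ℕ} {f f' : EuclideanSpace ℝ (Fin n) → ℝ → ℝ} {R c d : ℝ}

/-- A function that is bounded below by lines of slope `-K` across the gaps of a closed set, and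
whose derivative on that set exceeds `-K`, is bounded below by such lines from points of the set. -/
lemma sub_mul_le_of_gaps {g g' : ℝ → ℝ} {S : Set ℝ} (hS : IsClosed S) {K a b : ℝ} (hab : a ≤ b)
    (ha : a ∈ S) (hg : ∀ s ∈ Icc a b, HasDerivAt g (g' s) s) (hg' : ∀ s ∈ S ∩ Icc a b, -K < g' s)
    (hgap : ∀ s ∈ S ∩ Icc a b, ∀ t ∈ Ioc s b, Disjoint (Ioo s t) S → g s - K * (t - s) ≤ g t) :
    g a - K * (b - a) ≤ g b := by
  set u : ℝ → ℝ := fun s => g s + K * s with hu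
  suffices h : u a ≤ u b by
    simp only [hu] at h
    linarith
  have hgap' : ∀ s ∈ S ∩ Icc a b, ∀ t ∈ Ioc s b, Disjoint (Ioo s t) S → u s ≤ u t := by
    intro s hs t ht hd
    have := hgap s hs t ht hd
    simp only [hu]
    linarith
  have hud : ∀ s ∈ Icc a b, HasDerivAt u (g' s + K) s := fun s hs =>
    ((hg s hs).add ((hasDerivAt_id s).const_mul K)).congr_deriv (by ring)
  set Z := (S ∩ Icc a b) ∩ {s | u a ≤ u s} with hZ
  have hZc : IsCompact Z := by
    have h1 : IsClosed (Icc a b ∩ u ⁻¹' Ici (u a)) :=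
      ContinuousOn.preimage_isClosed_of_isClosed
        (fun s hs => (hud s hs).continuousAt.continuousWithinAt) isClosed_Icc isClosed_Ici
    have h2 : Z = S ∩ (Icc a b ∩ u ⁻¹' Ici (u a)) := by
      ext s
      simp [hZ, and_assoc]
    rw [h2]
    exact (isCompact_Icc.of_isClosed_subset h1 inter_subset_left).inter_left hS
  obtain ⟨σ, hσ⟩ := hZc.exists_isGreatest ⟨a, ⟨ha, le_rfl, hab⟩, le_refl (u a)⟩
  have hσu : u a ≤ u σ := hσ.1.2
  rcases hσ.1.1.2.2.eq_or_lt with h | hσb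
  · exact h ▸ hσu
  have hpos : 0 < g' σ + K := by linarith [hg' σ hσ.1.1]
  have hev : ∀ᶠ t in 𝓝[>] σ, u σ < u t := by
    have h2 := (hasDerivWithinAt_iff_tendsto_slope.1
      ((hud σ hσ.1.1.2).hasDerivWithinAt (s := Ioi σ)))
    rw [sdiff_singleton_eq_self (by simp)] at h2
    filter_upwards [h2.eventually_const_lt hpos, self_mem_nhdsWithin] with t ht hσt
    rw [slope_def_field, lt_div_iff₀ (sub_pos.2 hσt), zero_mul] at ht
    linarith
  obtain ⟨η, hη, hηu⟩ := (mem_nhdsGT_iff_exists_Ioo_subset' hσb).1 hev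
  have hnot : ∀ t ∈ S, σ < t → t ≤ b → u t < u a := by
    intro t ht hσt htb
    by_contra hcon
    exact absurd (hσ.2 ⟨⟨ht, hσ.1.1.2.1.trans hσt.le, htb⟩, not_lt.1 hcon⟩) (not_le.2 hσt)
  have hSη : ∀ t ∈ S, σ < t → t ≤ b → η ≤ t := by
    intro t ht hσt htb
    by_contra hcon
    have := hηu ⟨hσt, not_le.1 hcon⟩
    simp only [mem_ofPred_eq] at this
    linarith [hnot t ht hσt htb]
  by_cases hne : (S ∩ Icc η b).Nonempty
  · have hcomp : IsCompact (S ∩ Icc η b) := isCompact_Icc.inter_left hS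
    obtain ⟨τ, hτ⟩ := hcomp.exists_isLeast hne
    have hστ : σ < τ := lt_of_lt_of_le hη hτ.1.2.1
    have hd : Disjoint (Ioo σ τ) S := by
      rw [Set.disjoint_left]
      intro t ht htS
      have htb : t ≤ b := ht.2.le.trans hτ.1.2.2
      exact absurd (hτ.2 ⟨htS, hSη t htS ht.1 htb, htb⟩) (not_le.2 ht.2)
    have h1 := hgap' σ hσ.1.1 τ ⟨hστ, hτ.1.2.2⟩ hd
    linarith [hnot τ hτ.1.1 hστ hτ.1.2.2]
  · have hd : Disjoint (Ioo σ b) S := by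
      rw [Set.disjoint_left]
      intro t ht htS
      exact hne ⟨t, htS, hSη t htS ht.1 ht.2.le, ht.2.le⟩
    exact hσu.trans (hgap' σ hσ.1.1 b ⟨hσb, le_rfl⟩ hd)

lemma LocallyWeakSuper.mono {s : ℝ} (h : LocallyWeakSuper R f c d s) {c' d' : ℝ} (hc : c ≤ c')
    (hd : d' ≤ d) : LocallyWeakSuper R f c' d' s := by
  obtain ⟨δ, hδ, hw⟩ := h
  exact ⟨δ, hδ, fun a b ha hab hb => hw a b (hc.trans ha) hab (hb.trans hd)⟩

lemma IsSupersolution.weakSuper_of_gap (hf : IsSupersolution f f') {S : Set ℝ} (hc : 0 < c)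
    (hgood : ∀ s ∈ Icc c d, s ∉ S → LocallyWeakSuper R f c d s) {a b : ℝ} (ha : c ≤ a)
    (hab : a < b) (hb : b ≤ d) (hdisj : Disjoint (Ioo a b) S) : WeakSuper R f a b := by
  refine hf.weakSuper_of_Ioo (hc.trans_le ha) hab fun c' d' hc' hcd' hd' => ?_
  refine hf.weakSuper_of_locally (hc.trans_le (ha.trans hc'.le)) hcd'.le fun s hs => ?_
  refine (hgood s ⟨ha.trans (hc'.le.trans hs.1), hs.2.trans (hd'.le.trans hb)⟩ ?_).mono
    (ha.trans hc'.le) (hd'.le.trans hb)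
  exact Set.disjoint_left.1 hdisj ⟨hc'.trans_le hs.1, hs.2.trans_lt hd'⟩

lemma IsSupersolution.weakSuper_of_sliceBound (hf : IsSupersolution f f') {S : Set ℝ}
    (hS : IsClosed S) (hR : 0 < R) (hc : 0 < c) (hcd : c ≤ d) {k : ℝ} (hk : 0 ≤ k)
    (hST : ∀ s ∈ S ∩ Icc c d, SliceBound R f f' k s)
    (hgood : ∀ s ∈ Icc c d, s ∉ S → LocallyWeakSuper R f c d s) : WeakSuper R f c d := by
  have hlip : ∀ s ∈ S ∩ Icc c d, ∀ ρ < R, ∃ K, ∀ z, ‖z‖ ≤ ρ → ∀ s' ∈ Ioc s d,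
      f z s - K * (s' - s) ≤ f z s' := by
    intro s hs ρ hρ
    set ρ₀ := max ρ 0 with hρ₀
    have hρ₀R : ρ₀ < R := max_lt hρ hR
    have hρ₀0 : 0 ≤ ρ₀ := le_max_right _ _
    set e := (R - ρ₀) / 3 with he
    have he0 : 0 < e := by
      rw [he]
      linarith
    obtain ⟨χ, C, hχ⟩ := exists_isCutoff n (r := ρ₀ + e) (ρ := ρ₀ + 2 * e) (by positivity)
      (by linarith)
    obtain ⟨M, hM⟩ := hf.bound R c d hc
    set K := 2 * (commutatorBound n C (d - c + 1) e * M) + k with hK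
    set K' := max K (k + 1) with hK'
    refine ⟨K', fun z hz s' hs' => ?_⟩
    have hsub : Icc s s' ⊆ Icc c d := Icc_subset_Icc hs.2.1 hs'.2
    refine sub_mul_le_of_gaps (g' := f' z) hS hs'.1.le hs.1
      (fun t ht => hf.hasDerivAt z t (hc.trans_le (hsub ht).1)) (fun t ht => ?_)
      fun t ht t' ht' hdisj => ?_
    · have h1 := (hST t ⟨ht.1, hsub ht.2⟩).deriv_ge z (hz.trans hρ.le)
      linarith [le_max_right K (k + 1)]
    · have htc := (hsub ht.2).1
      have ht'd : t' ≤ d := ht'.2.trans hs'.2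
      have h1 := hf.sub_le_of_weakSuper hχ (R := R) (by linarith) (y := z) (A := d - c + 1)
        he0 (by linarith [le_max_left ρ 0]) (hc.trans_le htc) ht'.1 (by linarith) hk
        (fun u hu => hM u ⟨htc.trans hu.1, hu.2.trans ht'd⟩) (hST t ⟨ht.1, hsub ht.2⟩)
        (hf.weakSuper_of_gap hc hgood htc ht'.1 ht'd hdisj)
      have h2 : K * (t' - t) ≤ K' * (t' - t) :=
        mul_le_mul_of_nonneg_right (le_max_left _ _) (by linarith [ht'.1])
      linarith
  intro ψ ψ' hψ L hL
  refine hf.integral_le_of_right_growth hc hcd hψ fun s hs ε hε => ?_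
  by_cases hsS : s ∈ S
  · obtain ⟨s', h1, h2⟩ := ((hf.eventually_growth hc hψ hs
      (hlip s ⟨hsS, Ico_subset_Icc_self hs⟩) hε).and (Ioc_mem_nhdsGT hs.2)).exists
    refine ⟨s', h2, le_trans ?_ h1⟩
    have h3 := hL s (Ico_subset_Icc_self hs)
    nlinarith [h2.1]
  · exact (hgood s (Ico_subset_Icc_self hs) hsS).exists_growth hs hψ hL hε

lemma IsSupersolution.exists_sliceBound (hf : IsSupersolution f f') {t : ℝ} (ht : 0 < t) :
    ∃ k : ℕ, SliceBound R f f' k t := by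
  have hK := isCompact_closedBall (0 : EuclideanSpace ℝ (Fin n)) R
  obtain ⟨k₁, h₁⟩ := hK.exists_bound_of_continuousOn (hf.continuous ht).continuousOn
  obtain ⟨k₂, h₂⟩ := hK.exists_bound_of_continuousOn (hf.continuous_deriv t ht).continuousOn
  obtain ⟨k₃, h₃⟩ :=
    hK.exists_bound_of_continuousOn (continuous_lap (hf.contDiff t ht)).continuousOn
  obtain ⟨k, hk⟩ := exists_nat_ge (max k₁ (max k₂ k₃))
  have hk₁ : k₁ ≤ k := (le_max_left _ _).trans hk
  have hk₂ : k₂ ≤ k := ((le_max_left _ _).trans (le_max_right _ _)).trans hk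
  have hk₃ : k₃ ≤ k := ((le_max_right _ _).trans (le_max_right _ _)).trans hk
  refine ⟨k, fun z hz => (h₁ z (by simpa using hz)).trans hk₁,
    fun z hz => neg_le_of_abs_le ((h₂ z (by simpa using hz)).trans hk₂),
    fun χ hχ hχ0 ⟨ρ, hρ, hsupp⟩ => ?_⟩
  have hcs : HasCompactSupport χ := HasCompactSupport.intro (isCompact_closedBall 0 ρ)
    fun z hz => hsupp z (by simpa using hz)
  rw [← integral_mul_lap hχ hcs (hf.contDiff t ht), ← integral_const_mul]
  refine integral_mono ((hχ.continuous.integrable_of_hasCompactSupport hcs).const_mul _)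
    (integrable_mul_of_hasCompactSupport hχ.continuous (continuous_lap (hf.contDiff t ht)) hcs)
    fun z => ?_
  simp only
  by_cases hz : ‖z‖ ≤ ρ
  · have := neg_le_of_abs_le ((h₃ z (by simpa using hz.trans hρ.le)).trans hk₃)
    nlinarith [hχ0 z]
  · simp [hsupp z (not_le.1 hz)]

lemma IsSupersolution.isClosed_sliceBound (hf : IsSupersolution f f') (hc : 0 < c) (k : ℝ) :
    IsClosed {t | t ∈ Icc c d ∧ SliceBound R f f' k t} := by
  refine IsSeqClosed.isClosed fun u t hu hut => ?_
  have htI : t ∈ Icc c d := isClosed_Icc.mem_of_tendsto hut (Eventually.of_forall fun j => (hu j).1)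
  have ht : 0 < t := hc.trans_le htI.1
  have hlim : ∀ z, Tendsto (fun j => f z (u j)) atTop (𝓝 (f z t)) := fun z =>
    (hf.hasDerivAt z t ht).continuousAt.tendsto.comp hut
  refine ⟨htI, fun z hz => ?_, fun z hz => ?_, fun χ hχ hχ0 hsupp => ?_⟩
  · exact le_of_tendsto' (hlim z).abs fun j => (hu j).2.abs_le z hz
  · have h1 : Tendsto (fun j => f' z (u j)) atTop (𝓝 (f' z t)) :=
      ((hf.continuousOn_deriv z).continuousAt (Ioi_mem_nhds ht)).tendsto.comp hut
    exact ge_of_tendsto' h1 fun j => (hu j).2.deriv_ge z hz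
  · obtain ⟨ρ, hρ, hs⟩ := hsupp
    have hcs : HasCompactSupport χ := HasCompactSupport.intro (isCompact_closedBall 0 ρ)
      fun z hz => hs z (by simpa using hz)
    have hlc := continuous_lap hχ
    have hls := hasCompactSupport_lap hcs
    have hfc : ∀ j, Continuous fun z => f z (u j) := fun j =>
      hf.continuous (hc.trans_le (hu j).1.1)
    refine ge_of_tendsto' (tendsto_integral_of_dominated_convergence (fun z => |lap χ z| * k)
      (fun j => (hlc.mul (hfc j)).aestronglyMeasurable)
      ((hlc.integrable_of_hasCompactSupport hls).abs.mul_const k)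
      (fun j => Eventually.of_forall fun z => ?_)
      (Eventually.of_forall fun z => (hlim z).const_mul (lap χ z)))
      fun j => (hu j).2.lap_ge χ hχ hχ0 ⟨ρ, hρ, hs⟩
    change ‖lap χ z * f z (u j)‖ ≤ _
    rw [norm_mul, Real.norm_eq_abs, Real.norm_eq_abs]
    by_cases hz : ‖z‖ ≤ ρ
    · exact mul_le_mul_of_nonneg_left ((hu j).2.abs_le z (hz.trans hρ.le)) (abs_nonneg _)
    · have h1 : χ =ᶠ[𝓝 z] fun _ => 0 := by
        filter_upwards [(isOpen_lt continuous_const continuous_norm).mem_nhds (not_le.1 hz)]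
          with w hw using hs w hw
      simp [lap_eq_zero_of_eventuallyEq h1]

/-- A Baire category argument in time upgrades pointwise to integrated supersolutions. -/
theorem IsSupersolution.weakSuper (hf : IsSupersolution f f') (hR : 0 < R) (hc : 0 < c)
    (hcd : c ≤ d) : WeakSuper R f c d := by
  by_contra hcon
  set S := {s | s ∈ Icc c d ∧ ¬LocallyWeakSuper R f c d s} with hS
  have hopen : IsOpen {s | LocallyWeakSuper R f c d s} := by
    rw [Metric.isOpen_iff]
    rintro s ⟨δ, hδ, hw⟩
    refine ⟨δ / 2, by positivity, fun t ht => ⟨δ / 2, by positivity, fun a b ha hab hb h1 h2 => ?_⟩⟩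
    rw [Metric.mem_ball, Real.dist_eq, abs_lt] at ht
    exact hw a b ha hab hb (by linarith) (by linarith)
  have hSc : IsClosed S := isClosed_Icc.inter hopen.isClosed_compl
  have hSne : S.Nonempty := by
    by_contra hne
    refine hcon (hf.weakSuper_of_locally hc hcd fun s hs => ?_)
    by_contra h
    exact hne ⟨s, hs, h⟩
  have : Nonempty S := hSne.to_subtype
  have : CompleteSpace S := hSc.completeSpace_coe
  obtain ⟨k, ⟨s₀, hs₀⟩, hgi⟩ := nonempty_interior_of_iUnion_of_closed
    (f := fun k : ℕ => ((↑) : S → ℝ) ⁻¹' {t | t ∈ Icc c d ∧ SliceBound R f f' k t})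
    (fun k => (hf.isClosed_sliceBound hc k).preimage continuous_subtype_val) (by
      refine eq_univ_of_forall fun s => mem_iUnion.2 ?_
      obtain ⟨k, hk⟩ := hf.exists_sliceBound (R := R) (hc.trans_le s.2.1.1)
      exact ⟨k, s.2.1, hk⟩)
  obtain ⟨δ, hδ, hball⟩ := Metric.mem_nhds_iff.1 (mem_interior_iff_mem_nhds.1 hgi)
  refine hs₀.2 ⟨δ, hδ, fun a b ha hab hb h1 h2 => ?_⟩
  refine hf.weakSuper_of_sliceBound hSc hR (hc.trans_le ha) hab.le (Nat.cast_nonneg k)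
    (fun s hs => ?_) fun s hs hsS => ?_
  · refine (hball (a := ⟨s, hs.1⟩) ?_).2
    rw [Metric.mem_ball, Subtype.dist_eq, Real.dist_eq, abs_lt]
    constructor <;> simp only <;> linarith [hs.2.1, hs.2.2]
  · have hs' : s ∈ Icc c d := ⟨ha.trans hs.1, hs.2.trans hb⟩
    have : LocallyWeakSuper R f c d s := by
      by_contra h
      exact hsS ⟨hs', h⟩
    exact this.mono ha hb

end Baire

/-! ### Comparison with the Gaussian semigroup -/

section Comparison

variable {n : ℕ} {f f' : EuclideanSpace ℝ (Fin n) → ℝ → ℝ}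

lemma IsCutoff.abs_integral_kernelCommutator_mul_le_mul {χ : EuclideanSpace ℝ (Fin n) → ℝ}
    {r ρ C : ℝ} (hχ : IsCutoff χ r ρ C) {y : EuclideanSpace ℝ (Fin n)} {A e h B : ℝ} (he : 0 < e)
    (hy : ‖y‖ + e ≤ r) (hh : 0 < h) (hA : h ≤ A) {g : EuclideanSpace ℝ (Fin n) → ℝ}
    (hg : Integrable (fun z => heatKernel (z - y) (h + 1) * |g z|))
    (hB : ∫ z, heatKernel (z - y) (h + 1) * |g z| ≤ B) :
    |∫ z, kernelCommutator χ y h z * g z| ≤ commutatorBound n C A e * B := by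
  have hcb : 0 ≤ commutatorBound n C A e :=
    commutatorBound_nonneg hχ.const_nonneg (hh.le.trans hA) he.le
  refine le_trans ?_ (mul_le_mul_of_nonneg_left hB hcb)
  rw [← integral_const_mul, ← Real.norm_eq_abs]
  refine norm_integral_le_of_norm_le (hg.const_mul _) (Eventually.of_forall fun z => ?_)
  rw [norm_mul, Real.norm_eq_abs, Real.norm_eq_abs, ← mul_assoc]
  exact mul_le_mul_of_nonneg_right (hχ.abs_kernelCommutator_le he hy hh hA z) (abs_nonneg _)

/-- Backward Gaussian averages of a supersolution increase in time. -/
lemma IsSupersolution.integral_heatKernel_mono (hf : IsSupersolution f f') {τ t T B : ℝ}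
    (hτ : 0 < τ) (hτt : τ ≤ t) (htT : t < T) (x : EuclideanSpace ℝ (Fin n))
    (hB : ∀ s ∈ Icc τ t, Integrable (fun z => heatKernel (z - x) (T - s + 1) * |f z s|) ∧
      ∫ z, heatKernel (z - x) (T - s + 1) * |f z s| ≤ B)
    (h₁ : Integrable (fun z => heatKernel (z - x) (T - τ) * f z τ))
    (h₂ : Integrable (fun z => heatKernel (z - x) (T - t) * f z t)) :
    ∫ z, heatKernel (z - x) (T - τ) * f z τ ≤ ∫ z, heatKernel (z - x) (T - t) * f z t := by
  obtain ⟨C, hC⟩ := exists_isCutoff_uniform n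
  choose χ hχ using fun j : ℕ => hC (j + 1) (by linarith [(Nat.cast_nonneg j : (0 : ℝ) ≤ j)])
  have hcut : ∀ {u : EuclideanSpace ℝ (Fin n) → ℝ} {h : ℝ}, Continuous u →
      Integrable (fun z => heatKernel (z - x) h * u z) →
      Tendsto (fun j => ∫ z, χ j z * heatKernel (z - x) h * u z) atTop
        (𝓝 (∫ z, heatKernel (z - x) h * u z)) := by
    intro u h hu hi
    refine tendsto_integral_of_dominated_convergence (fun z => ‖heatKernel (z - x) h * u z‖)
      (fun j => ?_) hi.norm (fun j => Eventually.of_forall fun z => ?_)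
      (Eventually.of_forall fun z => ?_)
    · exact (((hχ j).contDiff.continuous.mul (continuous_heatKernel x h)).mul
        hu).aestronglyMeasurable
    · rw [mul_assoc, norm_mul]
      exact mul_le_of_le_one_left (norm_nonneg _) ((hχ j).abs_le_one z)
    · obtain ⟨N, hN⟩ := exists_nat_gt ‖z‖
      refine tendsto_const_nhds.congr' ?_
      filter_upwards [eventually_ge_atTop N] with j hj
      rw [(hχ j).eq_one z, one_mul]
      have : (N : ℝ) ≤ j := by exact_mod_cast hj
      linarith
  have hτ' := hcut (hf.continuous hτ) h₁
  have ht' := hcut (hf.continuous (hτ.trans_le hτt)) h₂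
  have hL : Tendsto (fun j : ℕ => commutatorBound n C (T - τ) (j + 1 - ‖x‖) * B * (t - τ)) atTop
      (𝓝 0) := by
    have h1 : Tendsto (fun j : ℕ => (j : ℝ) + 1 - ‖x‖) atTop atTop :=
      (tendsto_atTop_add_const_right _ (1 - ‖x‖) tendsto_natCast_atTop_atTop).congr
        fun j => by ring
    simpa using (((tendsto_commutatorBound n C (T - τ)).comp h1).mul_const B).mul_const (t - τ)
  have h3 := hτ'.sub hL
  rw [sub_zero] at h3
  refine le_of_tendsto_of_tendsto h3 ht' ?_
  obtain ⟨N, hN⟩ := exists_nat_gt ‖x‖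
  filter_upwards [eventually_ge_atTop N] with j hj
  have hj' : (N : ℝ) ≤ j := by exact_mod_cast hj
  have hj0 : (0 : ℝ) ≤ j := Nat.cast_nonneg j
  have hR : (0 : ℝ) < 2 * (j + 1) + 1 := by positivity
  refine hf.weakSuper hR hτ hτt _ _ ((hχ j).isTest (by linarith) htT x) _ fun s hs => ?_
  simp_rw [(hχ j).heat_operator_eq (hs.2.trans_lt htT)]
  exact neg_le_of_abs_le ((hχ j).abs_integral_kernelCommutator_mul_le_mul (by linarith)
    (by linarith) (show 0 < T - s by linarith [hs.2]) (by linarith [hs.1]) (hB s hs).1 (hB s hs).2)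

end Comparison

/-- Positive, separately regular solutions of the heat equation on `ℝⁿ × (0, ∞)`. -/
structure IsPosHeatSolution {n : ℕ} (p : EuclideanSpace ℝ (Fin n) → ℝ → ℝ) : Prop where
  pos : ∀ z s, 0 < s → 0 < p z s
  contDiff : ∀ s, 0 < s → ContDiff ℝ 2 (fun z => p z s)
  hasDerivAt : ∀ z s, 0 < s → HasDerivAt (p z) (lap (fun y => p y s) z) s
  continuousOn_lap : ∀ z, ContinuousOn (fun s => lap (fun y => p y s) z) (Ioi 0)

/-- A bounded concave truncation of the identity. -/
def expTrunc (η r : ℝ) : ℝ := (1 - exp (-η * r)) / η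

section Truncation

variable {n : ℕ} {p : EuclideanSpace ℝ (Fin n) → ℝ → ℝ} {η : ℝ}

lemma hasDerivAt_exp_neg_mul (η r : ℝ) :
    HasDerivAt (fun r => exp (-η * r)) (-η * exp (-η * r)) r := by
  have := ((hasDerivAt_id r).const_mul (-η)).exp
  refine this.congr_deriv ?_
  simp only [id]
  ring

lemma hasDerivAt_expTrunc (hη : 0 < η) (r : ℝ) :
    HasDerivAt (expTrunc η) (exp (-η * r)) r := by
  have := ((hasDerivAt_exp_neg_mul η r).const_sub 1).div_const η
  refine this.congr_deriv ?_
  field_simp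

lemma expTrunc_nonneg (hη : 0 < η) {r : ℝ} (hr : 0 ≤ r) : 0 ≤ expTrunc η r := by
  refine div_nonneg (sub_nonneg.2 (exp_le_one_iff.2 ?_)) hη.le
  nlinarith

lemma expTrunc_le (hη : 0 < η) (r : ℝ) : expTrunc η r ≤ r := by
  rw [expTrunc, div_le_iff₀ hη]
  linarith [add_one_le_exp (-η * r)]

lemma expTrunc_le_inv (hη : 0 < η) (r : ℝ) : expTrunc η r ≤ η⁻¹ := by
  rw [expTrunc, div_le_iff₀ hη, inv_mul_cancel₀ hη.ne']
  linarith [exp_pos (-η * r)]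

lemma tendsto_expTrunc (r : ℝ) : Tendsto (fun η => expTrunc η r) (𝓝[>] 0) (𝓝 r) := by
  have h1 : HasDerivAt (fun η : ℝ => 1 - exp (-r * η)) r 0 := by
    have := (hasDerivAt_exp_neg_mul r 0).const_sub 1
    simpa using this
  have h2 := (hasDerivWithinAt_iff_tendsto_slope.1 (h1.hasDerivWithinAt (s := Ioi 0)))
  rw [sdiff_singleton_eq_self (by simp)] at h2
  refine h2.congr fun η => ?_
  simp [slope_def_field, expTrunc, mul_comm]

lemma IsPosHeatSolution.continuous (hp : IsPosHeatSolution p) {s : ℝ} (hs : 0 < s) :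
    Continuous (fun z => p z s) := (hp.contDiff s hs).continuous

lemma IsPosHeatSolution.abs_expTrunc_le (hp : IsPosHeatSolution p) (hη : 0 < η) {s : ℝ}
    (hs : 0 < s) (z : EuclideanSpace ℝ (Fin n)) : |expTrunc η (p z s)| ≤ η⁻¹ := by
  rw [abs_of_nonneg (expTrunc_nonneg hη (hp.pos z s hs).le)]
  exact expTrunc_le_inv hη _

lemma IsPosHeatSolution.continuous_expTrunc (hp : IsPosHeatSolution p) (hη : 0 < η) {s : ℝ}
    (hs : 0 < s) : Continuous (fun z => expTrunc η (p z s)) :=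
  Continuous.comp (continuous_iff_continuousAt.2 fun r => (hasDerivAt_expTrunc hη r).continuousAt)
    (hp.continuous hs)

lemma IsTest.tendsto_integral_mul_of_dominated {R c d t : ℝ}
    {ψ ψ' f : EuclideanSpace ℝ (Fin n) → ℝ → ℝ} {G : EuclideanSpace ℝ (Fin n) → ℝ}
    (hψ : IsTest R c d ψ ψ') (ht : t ∈ Icc c d)
    (hf : ∀ s ∈ Icc c d, Continuous fun z => f z s)
    (hf' : ∀ z, ContinuousAt (f z) t) (hG : Continuous G)
    (hB : ∀ z, ∀ s ∈ Icc c d, |f z s| ≤ G z) :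
    Tendsto (fun s => ∫ z, ψ z s * f z s) (𝓝[Icc c d] t) (𝓝 (∫ z, ψ z t * f z t)) := by
  obtain ⟨ρ, C, -, hb⟩ := hψ.bound
  refine tendsto_integral_filter_of_dominated_convergence _
    (eventually_nhdsWithin_of_forall fun s hs =>
      (hψ.integrable_mul hs (hf s hs)).aestronglyMeasurable)
    (eventually_nhdsWithin_of_forall fun s hs => Eventually.of_forall fun z => ?_)
    (integrable_indicator_closedBall_mul hG ρ C)
    (Eventually.of_forall fun z => ?_)
  · rw [norm_mul, Real.norm_eq_abs, Real.norm_eq_abs]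
    exact mul_le_mul (hb z s hs).1 (hB z s hs) (abs_nonneg _)
      ((abs_nonneg _).trans (hb z s hs).1)
  · exact (((hψ.hasDerivAt z t ht).continuousAt.mul (hf' z)).tendsto).mono_left nhdsWithin_le_nhds

lemma IsPosHeatSolution.isSupersolution_expTrunc (hp : IsPosHeatSolution p) (hη : 0 < η) :
    IsSupersolution (fun z s => expTrunc η (p z s))
      (fun z s => exp (-η * p z s) * lap (fun y => p y s) z) := by
  have hd : ∀ z s, 0 < s → HasDerivAt (fun s => expTrunc η (p z s))
      (exp (-η * p z s) * lap (fun y => p y s) z) s := fun z s hs =>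
    (hasDerivAt_expTrunc hη (p z s)).comp s (hp.hasDerivAt z s hs)
  have hlim : ∀ {R c d t : ℝ} {ψ ψ' : EuclideanSpace ℝ (Fin n) → ℝ → ℝ}, 0 < c →
      IsTest R c d ψ ψ' → t ∈ Icc c d → Tendsto (fun s => ∫ z, ψ z s * expTrunc η (p z s))
        (𝓝[Icc c d] t) (𝓝 (∫ z, ψ z t * expTrunc η (p z t))) := by
    intro R c d t ψ ψ' hc hψ ht
    exact hψ.tendsto_integral_mul_of_dominated (f := fun z s => expTrunc η (p z s)) ht
      (fun s hs => hp.continuous_expTrunc hη (hc.trans_le hs.1))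
      (fun z => (hd z t (hc.trans_le ht.1)).continuousAt)
      continuous_const fun z s hs => hp.abs_expTrunc_le hη (hc.trans_le hs.1) z
  refine ⟨fun s hs => ?_, hd, fun s hs => ?_, fun z => ?_, fun z s hs => ?_,
    fun hc hψ t ht ε hε => ?_, fun hc hψ t ht ε hε => ?_, fun R a b ha => ?_⟩
  · exact (contDiff_const.sub ((contDiff_const.mul (hp.contDiff s hs)).exp)).div_const η
  · exact (continuous_const.mul (hp.continuous hs)).rexp.mul (continuous_lap (hp.contDiff s hs))
  · refine ContinuousOn.mul (ContinuousOn.rexp (continuousOn_const.mul fun s hs => ?_))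
      (hp.continuousOn_lap z)
    exact (hp.hasDerivAt z s hs).continuousAt.continuousWithinAt
  · rw [lap_comp (hasDerivAt_expTrunc hη) (hasDerivAt_exp_neg_mul η) (hp.contDiff s hs)]
    have h1 : 0 ≤ η * exp (-η * p z s) * ∑ i : Fin n,
        (fderiv ℝ (fun z => p z s) z (EuclideanSpace.single i 1)) ^ 2 := by positivity
    linarith
  · have h1 := (hlim hc hψ (Ioc_subset_Icc_self ht)).mono_left
      (nhdsWithin_le_of_mem (Icc_mem_nhdsLT_of_mem ht))
    filter_upwards [h1.eventually_lt_const (lt_add_of_pos_right _ hε)] with s hs using hs.le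
  · have h1 := (hlim hc hψ (Ico_subset_Icc_self ht)).mono_left
      (nhdsWithin_le_of_mem (Icc_mem_nhdsGT_of_mem ht))
    filter_upwards [h1.eventually_const_lt (sub_lt_self _ hε)] with s hs using by linarith
  · refine ⟨η⁻¹ * volume.real (Metric.closedBall (0 : EuclideanSpace ℝ (Fin n)) R), fun s hs => ?_⟩
    have h1 := norm_setIntegral_le_of_norm_le_const (μ := volume)
      (s := Metric.closedBall (0 : EuclideanSpace ℝ (Fin n)) R)
      (f := fun z => |expTrunc η (p z s)|) (C := η⁻¹)
      measure_closedBall_lt_top fun z _ => by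
        simpa using hp.abs_expTrunc_le hη (ha.trans_le hs.1) z
    exact (le_abs_self _).trans h1

/-- Positive solutions dominate the Gaussian averages of their earlier slices. -/
lemma IsPosHeatSolution.integral_heatKernel_mul_le (hp : IsPosHeatSolution p) {τ t : ℝ} (hτ : 0 < τ)
    (hτt : τ < t) (x : EuclideanSpace ℝ (Fin n)) :
    Integrable (fun z => heatKernel (z - x) (t - τ) * p z τ) ∧
      ∫ z, heatKernel (z - x) (t - τ) * p z τ ≤ p x t := by
  have ht : 0 < t := hτ.trans hτt
  have key : ∀ η : ℝ, 0 < η → ∫ z, heatKernel (z - x) (t - τ) * expTrunc η (p z τ) ≤ p x t := by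
    intro η hη
    have hgi : ∀ {h s : ℝ}, 0 < h → 0 < s →
        Integrable (fun z => heatKernel (z - x) h * expTrunc η (p z s)) := fun hh hs =>
      integrable_heatKernel_mul x hh (hp.continuous_expTrunc hη hs) (hp.abs_expTrunc_le hη hs)
    have hlim := (tendsto_integral_heatKernel_mul x (hp.continuous_expTrunc hη ht)
      (hp.abs_expTrunc_le hη ht)).comp (tendsto_sub_nhdsGT t)
    refine (integrable_and_integral_le_of_tendsto (l := 𝓝[>] t)
      (g := fun T z => heatKernel (z - x) (T - τ) * expTrunc η (p z τ)) ?_ ?_ (fun z => ?_) ?_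
      hlim).2.trans (expTrunc_le hη _)
    · filter_upwards [self_mem_nhdsWithin] with T hT
      exact hgi (sub_pos.2 (hτt.trans hT)) hτ
    · filter_upwards [self_mem_nhdsWithin] with T hT z
      exact mul_nonneg (heatKernel_pos _ (sub_pos.2 (hτt.trans hT))).le
        (expTrunc_nonneg hη (hp.pos z τ hτ).le)
    · refine Tendsto.mul_const _ ?_
      have h1 : ContinuousAt (fun T => heatKernel (z - x) (T - τ)) t :=
        ContinuousAt.comp (f := fun T => T - τ) (continuousAt_heatKernel (z - x) (sub_pos.2 hτt))
          (continuous_sub_right τ).continuousAt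
      exact h1.tendsto.mono_left nhdsWithin_le_nhds
    · filter_upwards [self_mem_nhdsWithin] with T hT
      have hT' : t < T := hT
      refine (hp.isSupersolution_expTrunc hη).integral_heatKernel_mono hτ hτt.le hT x (B := η⁻¹)
        (fun s hs => ?_) (hgi (by linarith) hτ) (hgi (by linarith) ht)
      have hs0 : 0 < s := hτ.trans_le hs.1
      have hh : 0 < T - s + 1 := by linarith [hs.2]
      have hb : ∀ z, |(|expTrunc η (p z s)|)| ≤ η⁻¹ := fun z => by
        simpa using hp.abs_expTrunc_le hη hs0 z
      exact ⟨integrable_heatKernel_mul x hh (hp.continuous_expTrunc hη hs0).abs hb,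
        (le_abs_self _).trans (abs_integral_heatKernel_mul_le x hh hb)⟩
  refine integrable_and_integral_le_of_tendsto (l := 𝓝[>] (0 : ℝ))
    (g := fun η z => heatKernel (z - x) (t - τ) * expTrunc η (p z τ)) (b := fun _ => p x t) ?_ ?_
    (fun z => (tendsto_expTrunc _).const_mul _) ?_ tendsto_const_nhds
  · filter_upwards [self_mem_nhdsWithin] with η hη
    exact integrable_heatKernel_mul x (sub_pos.2 hτt) (hp.continuous_expTrunc hη hτ)
      (hp.abs_expTrunc_le hη hτ)
  · filter_upwards [self_mem_nhdsWithin] with η hη z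
    exact mul_nonneg (heatKernel_pos _ (sub_pos.2 hτt)).le (expTrunc_nonneg hη (hp.pos z τ hτ).le)
  · filter_upwards [self_mem_nhdsWithin] with η hη using key η hη

end Truncation

/-! ### Absence of concentration -/

section Concentration

open Metric

variable {n : ℕ}

/-- The half-open box `J` as a subset of Euclidean space. -/
def euclideanBox (J : BoxIntegral.Box (Fin n)) : Set (EuclideanSpace ℝ (Fin n)) :=
  WithLp.ofLp ⁻¹' (J : Set (Fin n → ℝ))

lemma measurableSet_euclideanBox (J : BoxIntegral.Box (Fin n)) :
    MeasurableSet (euclideanBox J) :=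
  (PiLp.volume_preserving_ofLp (Fin n)).measurable J.measurableSet_coe

lemma volume_real_euclideanBox (J : BoxIntegral.Box (Fin n)) :
    volume.real (euclideanBox J) = ∏ i, (J.upper i - J.lower i) := by
  rw [measureReal_def, euclideanBox, (PiLp.volume_preserving_ofLp (Fin n)).measure_preimage
    J.measurableSet_coe.nullMeasurableSet, J.volume_apply']

lemma euclideanBox_subset_closedBall (J : BoxIntegral.Box (Fin n)) {x : EuclideanSpace ℝ (Fin n)}
    (hx : WithLp.ofLp x ∈ BoxIntegral.Box.Icc J) {ℓ : ℝ} (hℓ : 0 ≤ ℓ)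
    (hJ : ∀ i, J.upper i - J.lower i ≤ ℓ) : euclideanBox J ⊆ closedBall x (√n * ℓ) := by
  intro z hz
  have hz' : WithLp.ofLp z ∈ BoxIntegral.Box.Icc J := BoxIntegral.Box.coe_subset_Icc hz
  rw [mem_closedBall, EuclideanSpace.dist_eq, ← Real.sqrt_sq hℓ,
    ← Real.sqrt_mul (Nat.cast_nonneg n)]
  refine Real.sqrt_le_sqrt ?_
  calc ∑ i, dist (z i) (x i) ^ 2 ≤ ∑ _i : Fin n, ℓ ^ 2 := by
        refine Finset.sum_le_sum fun i _ => pow_le_pow_left₀ dist_nonneg ?_ 2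
        rw [Real.dist_eq, abs_le]
        have h1 := hx.1 i
        have h2 := hx.2 i
        have h3 := hz'.1 i
        have h4 := hz'.2 i
        constructor <;> linarith [hJ i]
    _ = n * ℓ ^ 2 := by simp

lemma integrableOn_euclideanBox (J : BoxIntegral.Box (Fin n)) {g : EuclideanSpace ℝ (Fin n) → ℝ}
    (hg : Continuous g) : IntegrableOn g (euclideanBox J) := by
  have h0 : ∀ i, 0 ≤ J.upper i - J.lower i := fun i => sub_nonneg.2 (J.lower_le_upper i)
  refine (hg.continuousOn.integrableOn_compact (isCompact_closedBall (WithLp.toLp 2 J.lower)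
    (√n * ∑ i, (J.upper i - J.lower i)))).mono_set (euclideanBox_subset_closedBall J
      J.lower_mem_Icc (Finset.sum_nonneg fun i _ => h0 i) fun i =>
        Finset.single_le_sum (f := fun i => J.upper i - J.lower i) (fun i _ => h0 i)
          (Finset.mem_univ i))

/-- A family of nonnegative functions whose masses near every point are eventually negligible at
every small scale converges to zero in `L¹` on balls. -/
lemma tendsto_integral_closedBall_of_negligible {ι : Type*} {l : Filter ι} (hn : 0 < n)
    {g : ι → EuclideanSpace ℝ (Fin n) → ℝ} (hc : ∀ᶠ s in l, Continuous (g s))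
    (h0 : ∀ s z, 0 ≤ g s z)
    (hloc : ∀ x, ∀ ε > 0, ∀ᶠ ℓ : ℝ in 𝓝[>] 0, ∀ᶠ s in l,
      ∫ z in closedBall x (√n * ℓ), g s z ≤ ε * ℓ ^ n) (R : ℝ) :
    Tendsto (fun s => ∫ z in closedBall 0 R, g s z) l (𝓝 0) := by
  have hbox : ∀ (I : BoxIntegral.Box (Fin n)), (∀ i j, I.upper i - I.lower i =
      I.upper j - I.lower j) → ∀ ε > 0, ∀ᶠ s in l, ∫ z in euclideanBox I, (g s z - ε) ≤ 0 := by
    intro I hI ε hε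
    refine BoxIntegral.Box.subbox_induction_on' (p := fun J =>
      ∀ᶠ s in l, ∫ z in euclideanBox J, (g s z - ε) ≤ 0) I (fun J _ hJ => ?_) fun x hx => ?_
    · filter_upwards [hc, eventually_all.2 hJ] with s hs hsJ
      have hs' : Continuous fun z => g s z - ε := hs.sub continuous_const
      have hU : euclideanBox J = ⋃ S, euclideanBox (J.splitCenterBox S) := by
        rw [euclideanBox, ← J.iUnion_coe_splitCenterBox, preimage_iUnion]
        rfl
      rw [hU, integral_iUnion_fintype (fun S => measurableSet_euclideanBox _)
        (fun S T hST => (J.disjoint_splitCenterBox hST).preimage _)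
        fun S => integrableOn_euclideanBox _ hs']
      exact Finset.sum_nonpos fun S _ => hsJ S
    · obtain ⟨δ, hδ, hδ'⟩ := (mem_nhdsGT_iff_exists_Ioo_subset).1 (hloc (WithLp.toLp 2 x) ε hε)
      refine ⟨ball x (δ / 2), mem_nhdsWithin_of_mem_nhds (ball_mem_nhds x (half_pos hδ)),
        fun J _ m hxJ hJ hside => ?_⟩
      set i₀ : Fin n := ⟨0, hn⟩
      set ℓ := J.upper i₀ - J.lower i₀ with hℓ
      have hside' : ∀ i, J.upper i - J.lower i = ℓ := fun i => by
        rw [hside, hI i i₀, hℓ, hside]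
      have hℓ0 : 0 < ℓ := sub_pos.2 (J.lower_lt_upper i₀)
      have hℓδ : ℓ < δ := by
        have h1 := hJ J.upper_mem_Icc
        have h2 := hJ J.lower_mem_Icc
        rw [mem_ball] at h1 h2
        have h3 := dist_le_pi_dist J.upper J.lower i₀
        have h4 := dist_triangle_right J.upper J.lower x
        rw [Real.dist_eq] at h3
        linarith [le_abs_self (J.upper i₀ - J.lower i₀)]
      have h5 : ∀ᶠ s in l, ∫ z in closedBall (WithLp.toLp 2 x) (√n * ℓ), g s z ≤ ε * ℓ ^ n :=
        hδ' ⟨hℓ0, hℓδ⟩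
      filter_upwards [h5, hc] with s hs hcs
      rw [integral_sub (integrableOn_euclideanBox J hcs)
        (integrableOn_euclideanBox J continuous_const), setIntegral_const,
        volume_real_euclideanBox, Finset.prod_congr rfl fun i _ => hside' i, Finset.prod_const,
        Finset.card_univ, Fintype.card_fin, smul_eq_mul]
      have h6 : ∫ z in euclideanBox J, g s z ≤
          ∫ z in closedBall (WithLp.toLp 2 x) (√n * ℓ), g s z :=
        setIntegral_mono_set
          (hcs.continuousOn.integrableOn_compact (isCompact_closedBall _ _))
          (Eventually.of_forall (h0 s)) (euclideanBox_subset_closedBall J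
            (x := WithLp.toLp 2 x) hxJ hℓ0.le fun i => (hside' i).le).eventuallyLE
      linarith
  obtain ⟨N, hN⟩ := exists_nat_gt |R|
  have hN0 : (0 : ℝ) < N := (abs_nonneg R).trans_lt hN
  set I : BoxIntegral.Box (Fin n) := ⟨fun _ => -N, fun _ => N, fun _ => by linarith⟩
  have hsub : closedBall 0 R ⊆ euclideanBox I := by
    intro z hz
    refine fun i => ?_
    have h1 : |z i| ≤ ‖z‖ := by simpa using PiLp.norm_apply_le z i
    rw [mem_closedBall_zero_iff] at hz
    have h2 := abs_lt.1 (h1.trans_lt (hz.trans_lt ((le_abs_self R).trans_lt hN)))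
    exact ⟨h2.1, h2.2.le⟩
  set V := volume.real (euclideanBox I)
  have hV : 0 ≤ V := measureReal_nonneg
  refine tendsto_order.2 ⟨fun a ha => Eventually.of_forall fun s =>
    ha.trans_le (integral_nonneg (h0 s)), fun a ha => ?_⟩
  filter_upwards [hbox I (fun _ _ => rfl) (a / (V + 1)) (by positivity), hc] with s hs hcs
  rw [integral_sub (integrableOn_euclideanBox I hcs)
    (integrableOn_euclideanBox I continuous_const), setIntegral_const, smul_eq_mul] at hs
  have h1 : ∫ z in closedBall 0 R, g s z ≤ ∫ z in euclideanBox I, g s z :=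
    setIntegral_mono_set (integrableOn_euclideanBox I hcs) (Eventually.of_forall (h0 s))
      hsub.eventuallyLE
  have h2 : V * (a / (V + 1)) < a := by
    rw [mul_div_assoc', div_lt_iff₀ (by linarith)]
    linarith
  linarith

lemma le_heatKernel_of_norm_le {w : EuclideanSpace ℝ (Fin n)} {h r : ℝ} (hh : 0 < h)
    (hw : ‖w‖ ≤ r) : (4 * π * h) ^ (-(n : ℝ) / 2) * exp (-r ^ 2 / (4 * h)) ≤ heatKernel w h := by
  unfold heatKernel
  gcongr

lemma setIntegral_le_inv_mul_integral_heatKernel_mul {S : Set (EuclideanSpace ℝ (Fin n))}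
    (hS : MeasurableSet S) {x : EuclideanSpace ℝ (Fin n)} {h κ : ℝ} (hh : 0 < h) (hκ : 0 < κ)
    (hlow : ∀ z ∈ S, κ ≤ heatKernel (z - x) h) {g : EuclideanSpace ℝ (Fin n) → ℝ}
    (hg : ∀ z, 0 ≤ g z) (hgi : Integrable (fun z => heatKernel (z - x) h * g z)) :
    ∫ z in S, g z ≤ κ⁻¹ * ∫ z, heatKernel (z - x) h * g z := by
  have hnn : ∀ z, 0 ≤ κ⁻¹ * (heatKernel (z - x) h * g z) := fun z => by
    have := heatKernel_pos (z - x) hh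
    have := hg z
    positivity
  rw [← integral_const_mul]
  refine le_trans ?_ (setIntegral_le_integral (s := S)
    (hgi.const_mul _) (Eventually.of_forall hnn))
  refine integral_mono_of_nonneg (Eventually.of_forall hg) (hgi.const_mul _).integrableOn ?_
  filter_upwards [ae_restrict_mem hS] with z hz
  rw [← mul_assoc, inv_mul_eq_div]
  exact le_mul_of_one_le_left (hg z) ((one_le_div hκ).2 (hlow z hz))

/-- The mass of a nonnegative function in a small ball is controlled by its Gaussian average at
the same scale. -/
lemma exists_setIntegral_closedBall_le (n : ℕ) : ∃ K > 0, ∀ (x : EuclideanSpace ℝ (Fin n)) (ℓ : ℝ)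
    (g : EuclideanSpace ℝ (Fin n) → ℝ), 0 < ℓ → (∀ z, 0 ≤ g z) →
    Integrable (fun z => heatKernel (z - x) (ℓ ^ 2) * g z) →
    ∫ z in closedBall x (√n * ℓ), g z ≤ K * ℓ ^ n * ∫ z, heatKernel (z - x) (ℓ ^ 2) * g z := by
  set κ := (4 * π) ^ (-(n : ℝ) / 2) * exp (-n / 4) with hκ
  have hκ0 : 0 < κ := by positivity
  refine ⟨κ⁻¹, inv_pos.2 hκ0, fun x ℓ g hℓ hg hgi => ?_⟩
  have hlow : ∀ z ∈ closedBall x (√n * ℓ), κ * (ℓ ^ n)⁻¹ ≤ heatKernel (z - x) (ℓ ^ 2) := by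
    intro z hz
    have h1 := le_heatKernel_of_norm_le (h := ℓ ^ 2) (by positivity) (mem_closedBall_iff_norm.1 hz)
    have h3 : -(√n * ℓ) ^ 2 / (4 * ℓ ^ 2) = -(n : ℝ) / 4 := by
      rw [mul_pow, Real.sq_sqrt (Nat.cast_nonneg n)]
      field_simp
    have h4 : (ℓ ^ 2) ^ (-(n : ℝ) / 2) = (ℓ ^ n)⁻¹ := by
      rw [← rpow_natCast ℓ 2, ← rpow_mul hℓ.le, ← rpow_natCast ℓ n, ← rpow_neg hℓ.le]
      congr 1
      push_cast
      ring
    rw [h3, mul_rpow (by positivity) (by positivity), h4] at h1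
    rw [hκ]
    linarith
  have h5 := setIntegral_le_inv_mul_integral_heatKernel_mul measurableSet_closedBall
    (pow_pos hℓ 2) (mul_pos hκ0 (inv_pos.2 (pow_pos hℓ n))) hlow hg hgi
  rwa [mul_inv, inv_inv] at h5

variable {p : EuclideanSpace ℝ (Fin n) → ℝ → ℝ}

lemma IsPosHeatSolution.continuousAt (hp : IsPosHeatSolution p) (z : EuclideanSpace ℝ (Fin n))
    {s : ℝ} (hs : 0 < s) : ContinuousAt (p z) s := (hp.hasDerivAt z s hs).continuousAt

lemma IsPosHeatSolution.tendsto_min (hp : IsPosHeatSolution p) (z : EuclideanSpace ℝ (Fin n))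
    {t : ℝ} (ht : 0 < t) : Tendsto (fun s => min (p z s) (p z t)) (𝓝 t) (𝓝 (p z t)) := by
  simpa using (hp.continuousAt z ht).tendsto.min (tendsto_const_nhds (x := p z t))

lemma IsPosHeatSolution.integrable_heatKernel_mul (hp : IsPosHeatSolution p) {h s : ℝ} (hh : 0 < h)
    (hs : 0 < s) (x : EuclideanSpace ℝ (Fin n)) :
    Integrable (fun z => heatKernel (z - x) h * p z s) := by
  simpa using (hp.integral_heatKernel_mul_le hs (lt_add_of_pos_right s hh) x).1

lemma IsPosHeatSolution.integral_heatKernel_le (hp : IsPosHeatSolution p) {h s : ℝ} (hh : 0 < h)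
    (hs : 0 < s) (x : EuclideanSpace ℝ (Fin n)) :
    ∫ z, heatKernel (z - x) h * p z s ≤ p x (s + h) := by
  simpa using (hp.integral_heatKernel_mul_le hs (lt_add_of_pos_right s hh) x).2

lemma IsPosHeatSolution.eventually_sub_integral_lt (hp : IsPosHeatSolution p) {a ε : ℝ} (ha : 0 < a)
    (hε : 0 < ε) (x : EuclideanSpace ℝ (Fin n)) :
    ∀ᶠ h in 𝓝[>] (0 : ℝ), p x (a + h) - ∫ z, heatKernel (z - x) h * p z a < ε := by
  have hb : ∀ z, |min (p z a) (p x a)| ≤ p x a := fun z => by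
    rw [abs_of_pos (lt_min (hp.pos z a ha) (hp.pos x a ha))]
    exact min_le_right _ _
  have hcm : Continuous fun z => min (p z a) (p x a) := (hp.continuous ha).min continuous_const
  have h1 := tendsto_integral_heatKernel_mul x hcm hb
  have h2 : Tendsto (fun h => p x (a + h)) (𝓝[>] 0) (𝓝 (p x a)) := by
    have h3 : ContinuousAt (fun h => p x (a + h)) 0 := by
      refine ContinuousAt.comp (f := fun h => a + h) ?_
        (continuous_const.add continuous_id).continuousAt
      simpa using hp.continuousAt x ha
    simpa using h3.tendsto.mono_left nhdsWithin_le_nhds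
  have h3 := h2.sub h1
  rw [min_self, sub_self] at h3
  filter_upwards [h3.eventually_lt_const hε, self_mem_nhdsWithin] with h hh hh0
  have h4 : ∫ z, heatKernel (z - x) h * min (p z a) (p x a) ≤ ∫ z, heatKernel (z - x) h * p z a :=
    integral_mono (_root_.integrable_heatKernel_mul x hh0 hcm hb)
      (hp.integrable_heatKernel_mul hh0 ha x) fun z =>
        mul_le_mul_of_nonneg_left (min_le_left _ _) (heatKernel_pos _ hh0).le
  linarith

/-- The positive part of the increment of a positive solution vanishes in `L¹` on balls. -/
lemma IsPosHeatSolution.tendsto_integral_sub_min (hp : IsPosHeatSolution p) (hn : 0 < n) {a : ℝ}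
    (ha : 0 < a) (R : ℝ) :
    Tendsto (fun s => ∫ z in closedBall 0 R, (p z s - min (p z s) (p z a))) (𝓝[>] a) (𝓝 0) := by
  obtain ⟨K, hK, hball⟩ := exists_setIntegral_closedBall_le n
  have hpos : ∀ᶠ s in 𝓝[>] a, 0 < s := by
    filter_upwards [self_mem_nhdsWithin] with s hs using ha.trans hs
  have h0 : ∀ s z, 0 ≤ p z s - min (p z s) (p z a) := fun s z => sub_nonneg.2 (min_le_left _ _)
  refine tendsto_integral_closedBall_of_negligible hn
    (g := fun s z => p z s - min (p z s) (p z a)) ?_ h0 (fun x ε hε => ?_) R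
  · filter_upwards [hpos] with s hs
    exact (hp.continuous hs).sub ((hp.continuous hs).min (hp.continuous ha))
  have hsq : Tendsto (fun ℓ : ℝ => ℓ ^ 2) (𝓝[>] 0) (𝓝[>] 0) := by
    refine tendsto_nhdsWithin_iff.2 ⟨?_, eventually_nhdsWithin_of_forall fun ℓ hℓ =>
      mem_Ioi.2 (pow_pos hℓ 2)⟩
    simpa using ((continuous_pow 2).tendsto (0 : ℝ)).mono_left nhdsWithin_le_nhds
  filter_upwards [hsq.eventually (hp.eventually_sub_integral_lt ha (div_pos hε hK) x),
    self_mem_nhdsWithin] with ℓ hℓ hℓ0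
  have hℓ0' : 0 < ℓ := hℓ0
  have hh : 0 < ℓ ^ 2 := pow_pos hℓ0' 2
  have hpa := hp.integrable_heatKernel_mul hh ha x
  have hmle : ∀ s, 0 < s → ∀ z, ‖heatKernel (z - x) (ℓ ^ 2) * min (p z s) (p z a)‖ ≤
      heatKernel (z - x) (ℓ ^ 2) * p z a := fun s hs z => by
    have h1 := heatKernel_pos (z - x) hh
    have h2 := lt_min (hp.pos z s hs) (hp.pos z a ha)
    rw [Real.norm_of_nonneg (by positivity)]
    exact mul_le_mul_of_nonneg_left (min_le_right _ _) h1.le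
  have hmeas : ∀ s, 0 < s → AEStronglyMeasurable
      (fun z => heatKernel (z - x) (ℓ ^ 2) * min (p z s) (p z a)) volume := fun s hs =>
    ((continuous_heatKernel x _).mul
      ((hp.continuous hs).min (hp.continuous ha))).aestronglyMeasurable
  have hlim : Tendsto (fun s => ∫ z, heatKernel (z - x) (ℓ ^ 2) * min (p z s) (p z a)) (𝓝[>] a)
      (𝓝 (∫ z, heatKernel (z - x) (ℓ ^ 2) * p z a)) := by
    refine tendsto_integral_filter_of_dominated_convergence _ (hpos.mono hmeas)
      (hpos.mono fun s hs => Eventually.of_forall (hmle s hs)) hpa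
      (Eventually.of_forall fun z => Tendsto.const_mul _ ?_)
    exact (hp.tendsto_min z ha).mono_left nhdsWithin_le_nhds
  have hlim' : Tendsto (fun s => p x (s + ℓ ^ 2)) (𝓝[>] a) (𝓝 (p x (a + ℓ ^ 2))) :=
    (ContinuousAt.comp (f := fun s => s + ℓ ^ 2) (hp.continuousAt x (by positivity))
      (continuous_add_const (ℓ ^ 2)).continuousAt).tendsto.mono_left nhdsWithin_le_nhds
  filter_upwards [(hlim'.sub hlim).eventually_lt_const hℓ, hpos] with s hs hs0
  have hps := hp.integrable_heatKernel_mul hh hs0 x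
  have hm : Integrable (fun z => heatKernel (z - x) (ℓ ^ 2) * min (p z s) (p z a)) :=
    hpa.mono' (hmeas s hs0) (Eventually.of_forall (hmle s hs0))
  have hsub : (fun z => heatKernel (z - x) (ℓ ^ 2) * (p z s - min (p z s) (p z a))) =
      fun z => heatKernel (z - x) (ℓ ^ 2) * p z s -
        heatKernel (z - x) (ℓ ^ 2) * min (p z s) (p z a) := by
    funext z
    ring
  have h1 := hball x ℓ (fun z => p z s - min (p z s) (p z a)) hℓ0' (h0 s)
    (by rw [hsub]; exact hps.sub hm)
  rw [hsub, integral_sub hps hm] at h1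
  refine h1.trans ?_
  have h2 : K * (∫ z, heatKernel (z - x) (ℓ ^ 2) * p z s) -
      K * ∫ z, heatKernel (z - x) (ℓ ^ 2) * min (p z s) (p z a) ≤ ε := by
    have h3 := hp.integral_heatKernel_le hh hs0 x
    rw [lt_div_iff₀ hK] at hs
    nlinarith
  have h4 : 0 < ℓ ^ n := pow_pos hℓ0' n
  nlinarith

end Concentration

/-! ### The semigroup property and the sharp Harnack inequality -/

section Harnack

open Metric

variable {n : ℕ} {p : EuclideanSpace ℝ (Fin n) → ℝ → ℝ}

lemma IsPosHeatSolution.exists_setIntegral_le (hp : IsPosHeatSolution p) (R b : ℝ) {a : ℝ}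
    (ha : 0 < a) : ∃ M, ∀ s ∈ Icc a b, ∫ z in closedBall 0 R, p z s ≤ M := by
  set κ := (4 * π * (b + 1 - a)) ^ (-(n : ℝ) / 2) * exp (-R ^ 2 / 4)
  refine ⟨κ⁻¹ * p 0 (b + 1), fun s hs => ?_⟩
  have hs0 : 0 < s := ha.trans_le hs.1
  have hh : 0 < b + 1 - s := by linarith [hs.2]
  have hh' : 0 < b + 1 - a := by linarith [hs.1]
  have hκ : 0 < κ := by positivity
  refine (setIntegral_le_inv_mul_integral_heatKernel_mul (x := 0) measurableSet_closedBall hh hκ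
    (fun z hz => ?_) (fun z => (hp.pos z s hs0).le)
    (hp.integrable_heatKernel_mul hh hs0 0)).trans
      (mul_le_mul_of_nonneg_left ?_ (inv_pos.2 hκ).le)
  · rw [mem_closedBall_zero_iff] at hz
    refine le_trans ?_ (le_heatKernel_of_norm_le hh (r := R) (by simpa using hz))
    refine mul_le_mul ?_ (exp_le_exp.2 ?_) (exp_pos _).le (by positivity)
    · refine rpow_le_rpow_of_nonpos (by positivity) ?_ ?_
      · have := hs.1
        gcongr
      · have : (0 : ℝ) ≤ n := Nat.cast_nonneg n
        linarith
    · rw [neg_div, neg_div, neg_le_neg_iff]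
      exact div_le_div_of_nonneg_left (sq_nonneg R) (by norm_num) (by linarith [hs.2])
  · simpa using hp.integral_heatKernel_le hh hs0 0

lemma IsPosHeatSolution.isSupersolution_neg (hp : IsPosHeatSolution p) (hn : 0 < n) :
    IsSupersolution (fun z s => -p z s) (fun z s => -lap (fun y => p y s) z) := by
  have hlim : ∀ {R c d t : ℝ} {ψ ψ' : EuclideanSpace ℝ (Fin n) → ℝ → ℝ}, 0 < c →
      IsTest R c d ψ ψ' → t ∈ Icc c d → Tendsto (fun s => ∫ z, ψ z s * min (p z s) (p z t))
        (𝓝[Icc c d] t) (𝓝 (∫ z, ψ z t * p z t)) := by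
    intro R c d t ψ ψ' hc hψ ht
    have ht0 : 0 < t := hc.trans_le ht.1
    have h1 := hψ.tendsto_integral_mul_of_dominated (f := fun z s => min (p z s) (p z t)) ht
      (fun s hs => (hp.continuous (hc.trans_le hs.1)).min (hp.continuous ht0))
      (fun z => by simpa [ContinuousAt] using hp.tendsto_min z ht0)
      (hp.continuous ht0) fun z s hs => by
        rw [abs_of_pos (lt_min (hp.pos z s (hc.trans_le hs.1)) (hp.pos z t ht0))]
        exact min_le_right _ _
    simpa using h1
  refine ⟨fun s hs => (hp.contDiff s hs).neg, fun z s hs => (hp.hasDerivAt z s hs).neg,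
    fun s hs => (continuous_lap (hp.contDiff s hs)).neg, fun z => (hp.continuousOn_lap z).neg,
    fun z s hs => (congrFun lap_neg z).le,
    fun {R c d ψ ψ'} hc hψ t ht ε hε => ?_, fun {R c d ψ ψ'} hc hψ t ht ε hε => ?_,
    fun R a b ha => ?_⟩
  · have ht0 : 0 < t := hc.trans ht.1
    have hmem : Icc c d ∈ 𝓝[<] t := Icc_mem_nhdsLT_of_mem ht
    have h1 := (hlim hc hψ (Ioc_subset_Icc_self ht)).mono_left (nhdsWithin_le_of_mem hmem)
    filter_upwards [h1.eventually_const_lt (sub_lt_self _ hε), hmem] with s hs hsc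
    have hs0 : 0 < s := hc.trans_le hsc.1
    have h2 : ∫ z, ψ z s * min (p z s) (p z t) ≤ ∫ z, ψ z s * p z s :=
      integral_mono (hψ.integrable_mul hsc ((hp.continuous hs0).min (hp.continuous ht0)))
        (hψ.integrable_mul hsc (hp.continuous hs0))
        fun z => mul_le_mul_of_nonneg_left (min_le_left _ _) (hψ.nonneg z s hsc)
    simp only [mul_neg, integral_neg]
    linarith
  · have ht0 : 0 < t := hc.trans_le ht.1
    have hmem : Icc c d ∈ 𝓝[>] t := Icc_mem_nhdsGT_of_mem ht
    have h1 := (hlim hc hψ (Ico_subset_Icc_self ht)).mono_left (nhdsWithin_le_of_mem hmem)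
    obtain ⟨ρ, C, -, hb⟩ := hψ.bound
    have h2 := h1.add ((hp.tendsto_integral_sub_min hn ht0 ρ).const_mul C)
    rw [mul_zero, add_zero] at h2
    filter_upwards [h2.eventually_lt_const (lt_add_of_pos_right _ hε), hmem] with s hs hsc
    have hs0 : 0 < s := hc.trans_le hsc.1
    have hmc : Continuous fun z => min (p z s) (p z t) :=
      (hp.continuous hs0).min (hp.continuous ht0)
    have hgc : Continuous fun z => p z s - min (p z s) (p z t) := (hp.continuous hs0).sub hmc
    have h3 : ∫ z, ψ z s * p z s = (∫ z, ψ z s * min (p z s) (p z t)) +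
        ∫ z, ψ z s * (p z s - min (p z s) (p z t)) := by
      rw [← integral_add (hψ.integrable_mul hsc hmc) (hψ.integrable_mul hsc hgc)]
      congr 1
      funext z
      ring
    have h4 : ∫ z, ψ z s * (p z s - min (p z s) (p z t)) ≤
        C * ∫ z in closedBall 0 ρ, (p z s - min (p z s) (p z t)) := by
      rw [← integral_const_mul, ← integral_indicator measurableSet_closedBall]
      simp_rw [indicator_mul_left]
      refine integral_mono (hψ.integrable_mul hsc hgc)
        (integrable_indicator_closedBall_mul hgc ρ C) fun z => ?_
      exact mul_le_mul_of_nonneg_right ((le_abs_self _).trans (hb z s hsc).1)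
        (sub_nonneg.2 (min_le_left _ _))
    simp only [mul_neg, integral_neg]
    linarith
  · obtain ⟨M, hM⟩ := hp.exists_setIntegral_le R b ha
    refine ⟨M, fun s hs => (le_of_eq ?_).trans (hM s hs)⟩
    congr 1
    funext z
    rw [abs_neg, abs_of_pos (hp.pos z s (ha.trans_le hs.1))]

/-- Backward Gaussian averages of a positive solution do not increase in time. -/
lemma IsPosHeatSolution.integral_heatKernel_antitone (hp : IsPosHeatSolution p) (hn : 0 < n)
    {τ t T : ℝ} (hτ : 0 < τ) (hτt : τ ≤ t) (htT : t < T) (x : EuclideanSpace ℝ (Fin n)) :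
    ∫ z, heatKernel (z - x) (T - t) * p z t ≤ ∫ z, heatKernel (z - x) (T - τ) * p z τ := by
  have hneg : ∀ {h s : ℝ}, 0 < h → 0 < s →
      Integrable (fun z => heatKernel (z - x) h * -p z s) := fun hh hs => by
    simp only [mul_neg]
    exact (hp.integrable_heatKernel_mul hh hs x).neg
  have h1 := (hp.isSupersolution_neg hn).integral_heatKernel_mono hτ hτt htT x
    (B := p x (T + 1)) (fun s hs => ?_) (hneg (by linarith) hτ)
    (hneg (by linarith) (hτ.trans_le hτt))
  · simp only [mul_neg, integral_neg] at h1
    linarith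
  · have hs0 : 0 < s := hτ.trans_le hs.1
    have hh : 0 < T - s + 1 := by linarith [hs.2]
    simp_rw [abs_neg, abs_of_pos (hp.pos _ s hs0)]
    refine ⟨hp.integrable_heatKernel_mul hh hs0 x, ?_⟩
    have h2 := hp.integral_heatKernel_le hh hs0 x
    rwa [show s + (T - s + 1) = T + 1 by ring] at h2

lemma sq_add_div_le {a b h k : ℝ} (hh : 0 < h) (hk : 0 < k) :
    (a + b) ^ 2 / (h + k) ≤ a ^ 2 / h + b ^ 2 / k := by
  rw [div_add_div _ _ hh.ne' hk.ne', div_le_div_iff₀ (by positivity) (by positivity)]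
  nlinarith [sq_nonneg (a * k - b * h)]

/-- Harnack inequality for the heat kernel. -/
lemma heatKernel_sub_le (x₁ x₂ z : EuclideanSpace ℝ (Fin n)) {h k : ℝ} (hh : 0 < h) (hk : h < k) :
    heatKernel (z - x₁) h ≤
      (k / h) ^ ((n : ℝ) / 2) * exp (‖x₁ - x₂‖ ^ 2 / (4 * (k - h))) * heatKernel (z - x₂) k := by
  have hk0 : 0 < k := hh.trans hk
  have h1 : ‖z - x₂‖ ^ 2 / k ≤ ‖z - x₁‖ ^ 2 / h + ‖x₁ - x₂‖ ^ 2 / (k - h) := by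
    refine le_trans ?_ (sq_add_div_le hh (sub_pos.2 hk))
    rw [add_sub_cancel]
    gcongr
    simpa using norm_add_le (z - x₁) (x₁ - x₂)
  have h2 : exp (-‖z - x₁‖ ^ 2 / (4 * h)) ≤
      exp (‖x₁ - x₂‖ ^ 2 / (4 * (k - h))) * exp (-‖z - x₂‖ ^ 2 / (4 * k)) := by
    rw [← exp_add, exp_le_exp]
    simp only [mul_comm (4 : ℝ), ← div_div, neg_div]
    linarith
  have h3 : (4 * π * h) ^ (-(n : ℝ) / 2) =
      (k / h) ^ ((n : ℝ) / 2) * (4 * π * k) ^ (-(n : ℝ) / 2) := by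
    rw [neg_div, rpow_neg (by positivity), rpow_neg (by positivity), ← inv_rpow (by positivity),
      ← inv_rpow (by positivity), ← mul_rpow (by positivity) (by positivity)]
    congr 1
    field_simp
  unfold heatKernel
  rw [h3]
  calc _ ≤ (k / h) ^ ((n : ℝ) / 2) * (4 * π * k) ^ (-(n : ℝ) / 2) *
        (exp (‖x₁ - x₂‖ ^ 2 / (4 * (k - h))) * exp (-‖z - x₂‖ ^ 2 / (4 * k))) := by gcongr
    _ = _ := by ring

/-- The sharp Harnack inequality on a time interval starting at a positive time. -/
lemma IsPosHeatSolution.le_of_lt (hp : IsPosHeatSolution p) (hn : 0 < n)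
    (x₁ x₂ : EuclideanSpace ℝ (Fin n)) {τ s₁ s₂ : ℝ} (hτ : 0 < τ) (hτs : τ < s₁) (hs : s₁ < s₂) :
    p x₁ s₁ ≤ ((s₂ - τ) / (s₁ - τ)) ^ ((n : ℝ) / 2) *
      exp (‖x₁ - x₂‖ ^ 2 / (4 * (s₂ - s₁))) * p x₂ s₂ := by
  have hs₁ : 0 < s₁ := hτ.trans hτs
  obtain ⟨χ, C, hχ⟩ := exists_isCutoff n (r := ‖x₁‖ + 1) (ρ := ‖x₁‖ + 2) (by positivity)
    (by linarith)
  have hlim := hχ.tendsto_integral (lt_add_one ‖x₁‖) (hp.continuous hs₁) s₁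
  have hlim' : Tendsto (fun T => ((s₂ - τ) / (T - τ)) ^ ((n : ℝ) / 2) *
      exp (‖x₁ - x₂‖ ^ 2 / (4 * (s₂ - T))) * p x₂ s₂) (𝓝[>] s₁)
      (𝓝 (((s₂ - τ) / (s₁ - τ)) ^ ((n : ℝ) / 2) *
        exp (‖x₁ - x₂‖ ^ 2 / (4 * (s₂ - s₁))) * p x₂ s₂)) := by
    have h1 : s₁ - τ ≠ 0 := (sub_pos.2 hτs).ne'
    have h2 : 4 * (s₂ - s₁) ≠ 0 := (mul_pos four_pos (sub_pos.2 hs)).ne'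
    have h3 : ContinuousAt (fun T => ((s₂ - τ) / (T - τ)) ^ ((n : ℝ) / 2) *
        exp (‖x₁ - x₂‖ ^ 2 / (4 * (s₂ - T))) * p x₂ s₂) s₁ := by
      refine ((ContinuousAt.rpow_const ?_ (Or.inr (by positivity))).mul
        (ContinuousAt.rexp ?_)).mul continuousAt_const
      · exact continuousAt_const.div (by fun_prop) h1
      · exact continuousAt_const.div (by fun_prop) h2
    exact h3.tendsto.mono_left nhdsWithin_le_nhds
  refine le_of_tendsto_of_tendsto hlim hlim' ?_
  filter_upwards [Ioo_mem_nhdsGT hs] with T hT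
  have hT1 : 0 < T - s₁ := sub_pos.2 hT.1
  have hTτ : 0 < T - τ := by linarith
  have hsτ : 0 < s₂ - τ := by linarith
  have hgi := hp.integrable_heatKernel_mul hsτ hτ x₂
  calc ∫ z, χ z * heatKernel (z - x₁) (T - s₁) * p z s₁
      ≤ ∫ z, heatKernel (z - x₁) (T - s₁) * p z s₁ := by
        refine integral_mono_of_nonneg (Eventually.of_forall fun z => ?_)
          (hp.integrable_heatKernel_mul hT1 hs₁ x₁) (Eventually.of_forall fun z => ?_)
        · exact mul_nonneg (mul_nonneg (hχ.nonneg z) (heatKernel_pos _ hT1).le) (hp.pos z s₁ hs₁).le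
        · exact mul_le_mul_of_nonneg_right (mul_le_of_le_one_left (heatKernel_pos _ hT1).le
            (hχ.le_one z)) (hp.pos z s₁ hs₁).le
    _ ≤ ∫ z, heatKernel (z - x₁) (T - τ) * p z τ :=
        hp.integral_heatKernel_antitone hn hτ hτs.le hT.1 x₁
    _ ≤ ∫ z, ((s₂ - τ) / (T - τ)) ^ ((n : ℝ) / 2) * exp (‖x₁ - x₂‖ ^ 2 / (4 * (s₂ - T))) *
          (heatKernel (z - x₂) (s₂ - τ) * p z τ) := by
        refine integral_mono (hp.integrable_heatKernel_mul hTτ hτ x₁) (hgi.const_mul _)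
          fun z => ?_
        have h1 := heatKernel_sub_le x₁ x₂ z hTτ (show T - τ < s₂ - τ by linarith [hT.2])
        rw [sub_sub_sub_cancel_right] at h1
        simpa only [mul_assoc] using mul_le_mul_of_nonneg_right h1 (hp.pos z τ hτ).le
    _ ≤ _ := by
        rw [integral_const_mul]
        refine mul_le_mul_of_nonneg_left ?_ (by positivity)
        simpa using hp.integral_heatKernel_le hsτ hτ x₂

/-- The sharp Harnack inequality for positive solutions of the heat equation. -/
theorem IsPosHeatSolution.harnack (hp : IsPosHeatSolution p) (hn : 0 < n)
    (x₁ x₂ : EuclideanSpace ℝ (Fin n)) {s₁ s₂ : ℝ} (hs₁ : 0 < s₁) (hs : s₁ < s₂) :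
    p x₁ s₁ ≤ (s₂ / s₁) ^ ((n : ℝ) / 2) * exp (‖x₁ - x₂‖ ^ 2 / (4 * (s₂ - s₁))) * p x₂ s₂ := by
  have hlim : Tendsto (fun τ => ((s₂ - τ) / (s₁ - τ)) ^ ((n : ℝ) / 2) *
      exp (‖x₁ - x₂‖ ^ 2 / (4 * (s₂ - s₁))) * p x₂ s₂) (𝓝[>] 0)
      (𝓝 ((s₂ / s₁) ^ ((n : ℝ) / 2) * exp (‖x₁ - x₂‖ ^ 2 / (4 * (s₂ - s₁))) * p x₂ s₂)) := by
    have h1 : ContinuousAt (fun τ => (s₂ - τ) / (s₁ - τ)) 0 :=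
      ContinuousAt.div (by fun_prop) (by fun_prop) (by simpa using hs₁.ne')
    have h2 := (h1.rpow_const (p := (n : ℝ) / 2) (Or.inr (by positivity))).tendsto
    rw [sub_zero, sub_zero] at h2
    exact ((h2.mono_left nhdsWithin_le_nhds).mul_const _).mul_const _
  refine ge_of_tendsto hlim ?_
  filter_upwards [Ioo_mem_nhdsGT hs₁] with τ hτ using hp.le_of_lt hn x₁ x₂ hτ.1 hτ.2 hs

end Harnack

/-- Harnack-type inequality for the VE-SDE (paper's Theorem 4).
If `p > 0` solves the heat equation `∂ₛ p = Δp` on `ℝⁿ × (0,∞)`, then for `α > 1`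
and `0 < s₁ < s₂`:
`p(x₁,s₁) ≤ p(x₂,s₂) (s₂/s₁)^{nα/2} exp(α²‖x₁-x₂‖²/(4(s₂-s₁)))`. -/
theorem ve_harnack
    (n : ℕ) (hn : 0 < n)
    (p : EuclideanSpace ℝ (Fin n) → ℝ → ℝ)
    (hpos : ∀ x, ∀ s : ℝ, 0 < s → 0 < p x s)
    (hreg_space : ∀ s : ℝ, 0 < s → ContDiff ℝ 2 (fun x => p x s))
    (hreg_time : ∀ x, ContDiffOn ℝ 1 (p x) (Set.Ioi (0 : ℝ)))
    (hheat : ∀ x, ∀ s : ℝ, 0 < s → deriv (p x) s = lap (fun y => p y s) x) :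
    ∀ α : ℝ, 1 < α →
      ∀ x₁ x₂ : EuclideanSpace ℝ (Fin n), ∀ s₁ s₂ : ℝ, 0 < s₁ → s₁ < s₂ →
        p x₁ s₁ ≤ p x₂ s₂ * (s₂ / s₁) ^ ((n : ℝ) * α / 2) *
          Real.exp (α ^ 2 * ‖x₁ - x₂‖ ^ 2 / (4 * (s₂ - s₁))) := by
  have hp : IsPosHeatSolution p := by
    refine ⟨hpos, hreg_space, fun z s hs => ?_, fun z => ?_⟩
    · rw [← hheat z s hs]
      exact (((hreg_time z).differentiableOn one_ne_zero s hs).differentiableAt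
        (Ioi_mem_nhds hs)).hasDerivAt
    · exact ((hreg_time z).continuousOn_deriv_of_isOpen isOpen_Ioi le_rfl).congr
        fun s hs => (hheat z s hs).symm
  intro α hα x₁ x₂ s₁ s₂ hs₁ hs
  have hs₁₂ : 0 < s₂ - s₁ := sub_pos.2 hs
  have hp₂ := hpos x₂ s₂ (hs₁.trans hs)
  have hn' : (0 : ℝ) ≤ n := Nat.cast_nonneg n
  have h1 : (s₂ / s₁) ^ ((n : ℝ) / 2) ≤ (s₂ / s₁) ^ ((n : ℝ) * α / 2) :=
    rpow_le_rpow_of_exponent_le ((one_le_div hs₁).2 hs.le) (by nlinarith)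
  have h2 : ‖x₁ - x₂‖ ^ 2 ≤ α ^ 2 * ‖x₁ - x₂‖ ^ 2 :=
    le_mul_of_one_le_left (sq_nonneg _) (by nlinarith)
  calc p x₁ s₁ ≤ (s₂ / s₁) ^ ((n : ℝ) / 2) * exp (‖x₁ - x₂‖ ^ 2 / (4 * (s₂ - s₁))) * p x₂ s₂ :=
        hp.harnack hn x₁ x₂ hs₁ hs
    _ = p x₂ s₂ * (s₂ / s₁) ^ ((n : ℝ) / 2) * exp (‖x₁ - x₂‖ ^ 2 / (4 * (s₂ - s₁))) := by ring
    _ ≤ _ := by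
        have : 0 ≤ (s₂ / s₁) ^ ((n : ℝ) * α / 2) :=
          rpow_nonneg (div_nonneg (hs₁.trans hs).le hs₁.le) _
        gcongr
end
end
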